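/- arXiv:2011.05221 — 2 statements merged into one kernel-verified Lean document; each statement's English description precedes it below -/
import Mathlib

section
/- Assume k < n+1 and 1 ≤ d ≤ k. Let id := (1 < 2 < ⋯ < k) ∈ W^P and let A_Z(d) be the set of u ∈ W^P ∩ W^odd with u(1) ≠ 1 such that there exists a chain of degree d from id W_P to u W_P in the moment graph of IG(k,2n+1). Then A_Z(d) has a maximal element with respect to the Bruhat order, and this maximal element is the minimal length representative of O_Y(d) W_P, which equals (2 < 3 < ⋯ < k < \overline{k+1}) if d = 1; (d+1 < d+2 < ⋯ < k < \overline{k+1} < \overline{d} < ⋯ < \overline{3} < \overline{2}) if 1 < d < k; and (\overline{k+1} < \overline{k} < ⋯ < \overline{3} < \overline{2}) if d = k. -/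
/-!
Common framework: the Weyl group of type `C_{m+1}` realized as signed permutations
of `Fin (2*m+2)` (values 0-indexed: the paper's 1-indexed value `a ∈ {1, …, 2m+2}`
corresponds to `a-1`, and the paper's `bar a = 2m+3-a` corresponds to `2m+2-a`).
For the odd symplectic Grassmannian `IG(k, 2n+1)` one takes `m = n`;
the smaller group `W_{2n}` of type `C_n` corresponds to `m = n-1`.
-/

namespace OddSymplectic

open Equiv

noncomputable section

/-- The element of `Fin (2*m+2)` with (0-indexed) value `i`. -/
def fn (m i : ℕ) : Fin (2*m+2) := ⟨i % (2*m+2), Nat.mod_lt _ (by omega)⟩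

/-- The bar involution on values. -/
def bar (m : ℕ) (j : Fin (2*m+2)) : Fin (2*m+2) := ⟨2*m+1 - (j:ℕ), by omega⟩

def barPerm (m : ℕ) : Equiv.Perm (Fin (2*m+2)) :=
  Function.Involutive.toPerm (bar m) (fun j => by
    have hj := j.isLt
    apply Fin.ext
    simp [bar]
    omega)

/-- The Weyl group of type `C_{m+1}`: the permutations of `Fin (2*m+2)` commuting with
the bar involution (signed permutations). -/
def Weyl (m : ℕ) : Subgroup (Equiv.Perm (Fin (2*m+2))) :=
  Subgroup.centralizer {barPerm m}

/-- The simple reflection `s_i`, `1 ≤ i ≤ m+1`. -/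
def sRefl (m i : ℕ) : Equiv.Perm (Fin (2*m+2)) :=
  if i ≤ m then
    Equiv.swap (fn m (i-1)) (fn m i) * Equiv.swap (fn m (2*m+2-i)) (fn m (2*m+1-i))
  else
    Equiv.swap (fn m m) (fn m (m+1))

/-- Coxeter length: the minimal length of an expression as a product of simple reflections. -/
def len (m : ℕ) (w : Equiv.Perm (Fin (2*m+2))) : ℕ :=
  sInf {r | ∃ l : List ℕ, l.length = r ∧ (∀ i ∈ l, 1 ≤ i ∧ i ≤ m+1) ∧
    (l.map (sRefl m)).prod = w}

/-- The set of reflections. -/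
def reflections (m : ℕ) : Set (Equiv.Perm (Fin (2*m+2))) :=
  {t | ∃ u ∈ Weyl m, ∃ i, 1 ≤ i ∧ i ≤ m+1 ∧ t = u * sRefl m i * u⁻¹}

/-- The Bruhat order. -/
def bruhatLE (m : ℕ) (u w : Equiv.Perm (Fin (2*m+2))) : Prop :=
  Relation.ReflTransGen (fun a b => ∃ t ∈ reflections m, b = a * t ∧ len m a < len m b) u w

/-- The parabolic subgroup `W_P` generated by the simple reflections `s_i`, `i ≠ kk`. -/
def WP (m kk : ℕ) : Subgroup (Equiv.Perm (Fin (2*m+2))) :=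
  Subgroup.closure {x | ∃ i, 1 ≤ i ∧ i ≤ m+1 ∧ i ≠ kk ∧ x = sRefl m i}

/-- `x W_P = y W_P`. -/
def cosetEq (m kk : ℕ) (x y : Equiv.Perm (Fin (2*m+2))) : Prop := x⁻¹ * y ∈ WP m kk

/-- `w ∈ W^P`: `w` is a minimal length representative of its coset `w W_P`. -/
def isMinRep (m kk : ℕ) (w : Equiv.Perm (Fin (2*m+2))) : Prop :=
  w ∈ Weyl m ∧ ∀ v ∈ WP m kk, len m w ≤ len m (w * v)

/-- `w ∈ W^{odd}`: `w(j) ≠ bar 1` for all `1 ≤ j ≤ m+1` (1-indexed positions). -/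
def isOdd (m : ℕ) (w : Equiv.Perm (Fin (2*m+2))) : Prop :=
  ∀ j : Fin (2*m+2), (j:ℕ) ≤ m → w j ≠ fn m (2*m+1)

/-- `w ∈ W°`: odd symplectic permutations with `w(j) ≠ 1` for `1 ≤ j ≤ kk`. -/
def isOpen (m kk : ℕ) (w : Equiv.Perm (Fin (2*m+2))) : Prop :=
  isOdd m w ∧ ∀ j : Fin (2*m+2), (j:ℕ) < kk → w j ≠ fn m 0

/-- `φ(u)`: the number of barred entries among the first `kk` values of `u`. -/
def phi (m kk : ℕ) (u : Equiv.Perm (Fin (2*m+2))) : ℕ :=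
  (Finset.univ.filter (fun j : Fin (2*m+2) => (j:ℕ) < kk ∧ m+1 ≤ ((u j : ℕ)))).card

/-- The set of values of `w` on the first `kk` positions. -/
def valSet (m kk : ℕ) (w : Equiv.Perm (Fin (2*m+2))) : Finset (Fin (2*m+2)) :=
  (Finset.univ.filter (fun j : Fin (2*m+2) => (j:ℕ) < kk)).image w

/-- The (1-indexed) absolute value `|x|` of a signed entry. -/
def absVal (m : ℕ) (x : Fin (2*m+2)) : ℕ :=
  if (x:ℕ) ≤ m then (x:ℕ)+1 else 2*m+2-(x:ℕ)

/-! ### Hecke products -/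

def hStep (m : ℕ) (w : Equiv.Perm (Fin (2*m+2))) (i : ℕ) : Equiv.Perm (Fin (2*m+2)) :=
  if len m w < len m (w * sRefl m i) then w * sRefl m i else w

/-- Hecke product of `w` with the word `l` of simple reflections. -/
def hWord (m : ℕ) (w : Equiv.Perm (Fin (2*m+2))) (l : List ℕ) : Equiv.Perm (Fin (2*m+2)) :=
  l.foldl (hStep m) w

def hStepK (m kk : ℕ) (w : Equiv.Perm (Fin (2*m+2))) (i : ℕ) : Equiv.Perm (Fin (2*m+2)) :=
  if len m w < len m (w * sRefl m i) ∨ i = kk then w * sRefl m i else w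

/-- Modified Hecke product `·_k` of `w` with the word `l`. -/
def hWordK (m kk : ℕ) (w : Equiv.Perm (Fin (2*m+2))) (l : List ℕ) : Equiv.Perm (Fin (2*m+2)) :=
  l.foldl (hStepK m kk) w

/-- The list `[a, a+1, …, b]`. -/
def ascList (a b : ℕ) : List ℕ := List.range' a (b+1-a)

/-- The word `s_1 s_2 ⋯ s_{m+1} ⋯ s_2 s_1` for `O^∘(1)`. -/
def wordOcirc1 (m : ℕ) : List ℕ := ascList 1 (m+1) ++ (ascList 1 m).reverse

/-- The word `s_1 ⋯ s_{kk-1} s_{kk+1} ⋯ s_{m+1} ⋯ s_2 s_1` for `O_Y(1)`. -/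
def wordOY1 (m kk : ℕ) : List ℕ :=
  ascList 1 (kk-1) ++ ascList (kk+1) (m+1) ++ (ascList 1 m).reverse

/-- The word `s_2 ⋯ s_{m+1} ⋯ s_2` for `O_Z(1)`. -/
def wordOZ1 (m : ℕ) : List ℕ := ascList 2 (m+1) ++ (ascList 2 m).reverse

def wordOcirc (m d : ℕ) : List ℕ := (List.replicate d (wordOcirc1 m)).flatten
def wordOZ (m d : ℕ) : List ℕ := (List.replicate d (wordOZ1 m)).flatten

/-- `w ·_k O^∘(d)`. -/
def mulOcirc (m kk : ℕ) (w : Equiv.Perm (Fin (2*m+2))) (d : ℕ) : Equiv.Perm (Fin (2*m+2)) :=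
  hWordK m kk w (wordOcirc m d)

/-- `w · O_Z(d)`. -/
def mulOZ (m : ℕ) (w : Equiv.Perm (Fin (2*m+2))) (d : ℕ) : Equiv.Perm (Fin (2*m+2)) :=
  hWord m w (wordOZ m d)

/-- `w · O_Y(1)`. -/
def mulOY1 (m kk : ℕ) (w : Equiv.Perm (Fin (2*m+2))) : Equiv.Perm (Fin (2*m+2)) :=
  hWord m w (wordOY1 m kk)

/-- `w · O_Y(d) = (w · O_Y(1)) ·_k O^∘(d-1)`. -/
def mulOY (m kk : ℕ) (w : Equiv.Perm (Fin (2*m+2))) (d : ℕ) : Equiv.Perm (Fin (2*m+2)) :=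
  mulOcirc m kk (mulOY1 m kk w) (d-1)

/-! ### Positive roots of type `C_{m+1}` -/

/-- Positive roots of type `C_{m+1}` (1-indexed `i < j ≤ m+1`). -/
inductive PosRoot : Type
  | tm (i j : ℕ)   -- `t_i - t_j`
  | tp (i j : ℕ)   -- `t_i + t_j`
  | lg (i : ℕ)     -- `2 t_i`

def PosRoot.valid (m : ℕ) : PosRoot → Prop
  | .tm i j => 1 ≤ i ∧ i < j ∧ j ≤ m+1
  | .tp i j => 1 ≤ i ∧ i < j ∧ j ≤ m+1
  | .lg i => 1 ≤ i ∧ i ≤ m+1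

/-- The reflection `s_α`. -/
def PosRoot.refl (m : ℕ) : PosRoot → Equiv.Perm (Fin (2*m+2))
  | .tm i j => Equiv.swap (fn m (i-1)) (fn m (j-1)) *
      Equiv.swap (fn m (2*m+2-i)) (fn m (2*m+2-j))
  | .tp i j => Equiv.swap (fn m (i-1)) (fn m (2*m+2-j)) *
      Equiv.swap (fn m (j-1)) (fn m (2*m+2-i))
  | .lg i => Equiv.swap (fn m (i-1)) (fn m (2*m+2-i))

/-- The coefficient of the simple root `α_kk` in the expansion of `α` in simple roots. -/
def PosRoot.rootCoeff (m kk : ℕ) : PosRoot → ℕ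
  | .tm i j => if i ≤ kk ∧ kk < j then 1 else 0
  | .tp i j => if i ≤ kk ∧ kk < j then 1 else if j ≤ kk ∧ kk ≤ m then 2
      else if j ≤ kk then 1 else 0
  | .lg i => if i ≤ kk ∧ kk ≤ m then 2 else if i ≤ kk then 1 else 0

/-- The coefficient of the simple coroot `α_kk^∨` in the expansion of `α^∨` in simple
coroots: the degree of the corresponding edge of the moment graph. -/
def PosRoot.corootCoeff (kk : ℕ) : PosRoot → ℕ
  | .tm i j => if i ≤ kk ∧ kk < j then 1 else 0
  | .tp i j => if i ≤ kk ∧ kk < j then 1 else if j ≤ kk then 2 else 0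
  | .lg i => if i ≤ kk then 1 else 0

/-- `α ∈ R_1^+`. -/
def PosRoot.inR1 (m kk : ℕ) : PosRoot → Bool
  | .tm i j => decide (1 ≤ i ∧ i ≤ kk ∧ kk < j ∧ j ≤ m+1)
  | .tp i j => decide (1 ≤ i ∧ i ≤ kk ∧ kk < j ∧ j ≤ m+1)
  | .lg i => decide (1 ≤ i ∧ i ≤ kk)

/-- `α ∈ R_2^+`. -/
def PosRoot.inR2 (kk : ℕ) : PosRoot → Bool
  | .tp i j => decide (1 ≤ i ∧ i < j ∧ j ≤ kk)
  | _ => false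

/-- Chains in the moment graph of `IG(kk, 2m+2)`, recorded with their list of roots:
each step goes from the vertex `u W_P` to the vertex with minimal length representative
`v`, where `v W_P = u s_α W_P` and `α ∈ R^+ \ R_P^+`. -/
inductive Chain (m kk : ℕ) :
    Equiv.Perm (Fin (2*m+2)) → Equiv.Perm (Fin (2*m+2)) → List PosRoot → Prop
  | nil (u : Equiv.Perm (Fin (2*m+2))) : Chain m kk u u []
  | cons {u w : Equiv.Perm (Fin (2*m+2))} {l : List PosRoot}
      (a : PosRoot) (v : Equiv.Perm (Fin (2*m+2))) :
      a.valid m → a.rootCoeff m kk ≠ 0 → isMinRep m kk v →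
      cosetEq m kk v (u * a.refl m) → Chain m kk v w l → Chain m kk u w (a :: l)

/-- The degree of a chain: the sum of the degrees of its edges. -/
def chainDeg (kk : ℕ) (l : List PosRoot) : ℕ := (l.map (PosRoot.corootCoeff kk)).sum

/-- Chains of a given total degree in the moment graph of `IG(kk, 2m+1)`
(the full subgraph of the moment graph of `IG(kk, 2m+2)` on `W^P ∩ W^{odd}`). -/
inductive ChainO (m kk : ℕ) :
    Equiv.Perm (Fin (2*m+2)) → Equiv.Perm (Fin (2*m+2)) → ℕ → Prop
  | nil (u : Equiv.Perm (Fin (2*m+2))) : ChainO m kk u u 0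
  | cons {u w : Equiv.Perm (Fin (2*m+2))} {d : ℕ}
      (a : PosRoot) (v : Equiv.Perm (Fin (2*m+2))) :
      a.valid m → a.rootCoeff m kk ≠ 0 → isMinRep m kk v → isOdd m v →
      cosetEq m kk v (u * a.refl m) → ChainO m kk v w d →
      ChainO m kk u w (a.corootCoeff kk + d)

/-! ### The maps `Φ`, `Φ_Z`, `ψ` -/

/-- The relation `Φ(w W_P) = w' W_Y`, for `w` in the type `C_{n+1}` group and `w'` in the
type `C_n` group (entrywise shift of the first `kk` values). -/
def PhiRel (n kk : ℕ) (w : Equiv.Perm (Fin (2*n+2)))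
    (w' : Equiv.Perm (Fin (2*(n-1)+2))) : Prop :=
  ∀ j, j < kk → ((w' (fn (n-1) j) : ℕ) + 1 = (w (fn n j) : ℕ))

/-- The relation `Φ_Z(w W_P) = w' W_Z` (entrywise shift of the values in positions
`2, …, kk`). -/
def PhiZRel (n kk : ℕ) (w : Equiv.Perm (Fin (2*n+2)))
    (w' : Equiv.Perm (Fin (2*(n-1)+2))) : Prop :=
  ∀ j, j + 1 < kk → ((w' (fn (n-1) j) : ℕ) + 1 = (w (fn n (j+1)) : ℕ))

/-- The word `ψ(s_i)`. -/
def psiWord (kk i : ℕ) : List ℕ :=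
  if i ≤ kk-1 then [i] else if i = kk then [kk, kk+1, kk] else [i+1]

/-- `j ↦ min({2,…,m+1} \ {|w(p)|, …, |w(kk)|})` (1-indexed positions `p ≤ j ≤ kk`). -/
def jmin (m kk p : ℕ) (w : Equiv.Perm (Fin (2*m+2))) : ℕ :=
  sInf {i | 2 ≤ i ∧ i ≤ m+1 ∧ ∀ j, p ≤ j → j ≤ kk → absVal m (w (fn m (j-1))) ≠ i}

/-! ### Partitions -/

/-- `μ ∈ Part(k, N)`, encoded as a function `ℕ → ℤ` supported on `{1, …, k}`. -/
def IsPart (k N : ℕ) (μ : ℕ → ℤ) : Prop :=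
  (∀ j, 1 ≤ j → j < k → μ (j+1) ≤ μ j) ∧ μ 1 ≤ (N:ℤ) - k ∧
  (∀ j, 1 ≤ j → j ≤ k → 0 ≤ μ j) ∧ (∀ j, j = 0 ∨ k < j → μ j = 0)

/-- `D(μ)(i)`: the `i`-th step of the boundary path of the Young diagram of `μ` inside
the `k × (N-k)` rectangle (from northeast to southwest) is vertical. -/
def Dword (k N : ℕ) (μ : ℕ → ℤ) (i : ℕ) : Prop :=
  ∃ j, 1 ≤ j ∧ j ≤ k ∧ (i:ℤ) = (N:ℤ) - k - μ j + j

/-- `μ ∈ BC(k, 2n+2)`. -/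
def IsBCeven (n k : ℕ) (μ : ℕ → ℤ) : Prop :=
  IsPart k (2*n+2) μ ∧
  ∀ i, 1 ≤ i → i ≤ n+1 → ¬(Dword k (2*n+2) μ i ∧ Dword k (2*n+2) μ (2*n+3-i))

/-- `λ + 1^k`. -/
def addOne (k : ℕ) (lam : ℕ → ℤ) (j : ℕ) : ℤ := if 1 ≤ j ∧ j ≤ k then lam j + 1 else 0

/-- `λ ∈ BC(k, 2n+1)`: `λ ∈ Part(k, 2n+1)` and `λ + 1^k ∈ BC(k, 2n+2)`. -/
def IsBCodd (n k : ℕ) (lam : ℕ → ℤ) : Prop :=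
  IsPart k (2*n+1) lam ∧ IsBCeven n k (addOne k lam)

/-- `β ∈ BKT(k, 2n+2)`: `(n+1-k)`-strict partitions. -/
def IsBKTeven (n k : ℕ) (β : ℕ → ℤ) : Prop :=
  IsPart k (2*n+2) β ∧ ∀ j, 1 ≤ j → j < k → ((n:ℤ)+1-k < β j → β (j+1) < β j)

/-- `α ∈ BKT(k, 2n+1)`: `α = β - 1^k` with `β ∈ BKT(k, 2n+2)`. -/
def IsBKTodd (n k : ℕ) (α : ℕ → ℤ) : Prop :=
  IsBKTeven n k (addOne k α) ∧ (∀ j, j = 0 ∨ k < j → α j = 0)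

/-- `ℓ(λ)`: the number of nonzero parts. -/
def numParts (k : ℕ) (lam : ℕ → ℤ) : ℕ :=
  ((Finset.Icc 1 k).filter (fun j => lam j ≠ 0)).card

/-- `ℓ_i^d(λ) = #{j > d : λ_j > i}`. -/
def elld (k : ℕ) (lam : ℕ → ℤ) (i : ℤ) (d : ℕ) : ℕ :=
  ((Finset.Icc 1 k).filter (fun j => d < j ∧ i < lam j)).card

/-- `λ^{O∘(1)} = (λ_2-1, …, λ_{ℓ(λ)}-1, 0, …, 0)`. -/
def Oc1 (k : ℕ) (lam : ℕ → ℤ) (j : ℕ) : ℤ :=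
  if 1 ≤ j ∧ j + 1 ≤ numParts k lam then lam (j+1) - 1 else 0

/-- `λ^{O∘(d)}`. -/
def OcD (k : ℕ) (lam : ℕ → ℤ) : ℕ → ℕ → ℤ
  | 0 => lam
  | d+1 => Oc1 k (OcD k lam d)

/-- `λ^{O_Z(1)} = (λ_1, λ_3-1, …, λ_{ℓ(λ)}-1, 0, …, 0)` for `λ ∈ BC(k, 2n+1)`. -/
def OZ1 (k : ℕ) (lam : ℕ → ℤ) (j : ℕ) : ℤ :=
  if j = 1 then lam 1
  else if 2 ≤ j ∧ j + 1 ≤ numParts k lam then lam (j+1) - 1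
  else 0

/-- `λ^{O_Z(d)}`. -/
def OZd (k : ℕ) (lam : ℕ → ℤ) : ℕ → ℕ → ℤ
  | 0 => lam
  | d+1 => OZ1 k (OZd k lam d)

/-- `Comp_BC(d)`. -/
def CompBC (n k d : ℕ) (lam : ℕ → ℤ) : Prop :=
  IsBCodd n k lam ∧ lam 1 = 2*(n:ℤ)+1-k ∧
  lam (d+1) - (elld k lam ((d:ℤ)-1) (d+1) : ℤ) - d = 2*((n:ℤ)+1-k)

/-- The transposed partition. -/
def transpose (k : ℕ) (μ : ℕ → ℤ) (j : ℕ) : ℤ :=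
  if 1 ≤ j then (((Finset.Icc 1 k).filter (fun i => (j:ℤ) ≤ μ i)).card : ℤ) else 0

/-- `D(μ)(i) = D(μ^t)(i)`. -/
def wingAgree (n k : ℕ) (μ : ℕ → ℤ) (i : ℕ) : Prop :=
  Dword k (2*n+2) μ i ↔ Dword (2*n+2-k) (2*n+2) (transpose k μ) i

/-- `μ ∈ Part(k, 2n+2)` is `m`-wingtip symmetric. -/
def isWingtipEven (n k : ℕ) (μ : ℕ → ℤ) (m : ℕ) : Prop :=
  (∀ i, 1 ≤ i → i ≤ m → wingAgree n k μ i) ∧ (m = 2*n+2 ∨ ¬ wingAgree n k μ (m+1))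

/-- `λ ∈ BC(k, 2n+1)` is `m`-wingtip symmetric. -/
def isWingtip (n k : ℕ) (lam : ℕ → ℤ) (m : ℕ) : Prop :=
  isWingtipEven n k (addOne k lam) m

open scoped Classical in
/-- `λ^{O_Y(1)}` for an `m`-wingtip symmetric `λ ∈ BC(k, 2n+1)` with `λ_1 = 2n+1-k`. -/
def OY1 (n k m : ℕ) (lam : ℕ → ℤ) : ℕ → ℤ :=
  -- the step of `D(λ)` at position `bar m = 2n+3-m`
  let s := 2*n+3-m
  -- the row at (or just above) the step at position `s`
  let i := ((Finset.Icc 1 s).filter (fun t => Dword k (2*n+2) (addOne k lam) t)).card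
  -- the column of the step at position `s` (when horizontal)
  let j := (2*n+2-k) + 1 -
    ((Finset.Icc 1 s).filter (fun t => ¬ Dword k (2*n+2) (addOne k lam) t)).card
  if Dword k (2*n+2) (addOne k lam) s then
    -- `D(λ)(bar m) = 1` is the `i`-th 1: `(λ_2-1, …, λ_{i-1}-1, λ_i, λ_i, λ_{i+1}, …, λ_k)`
    fun p =>
      if 1 ≤ p ∧ p + 2 ≤ i then lam (p+1) - 1
      else if (p = i - 1 ∨ p = i) ∧ 1 ≤ p ∧ p ≤ k then lam i
      else if i + 1 ≤ p ∧ p ≤ k then lam p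
      else 0
  else
    -- horizontal step at the bottom of row `i`, column `j`:
    -- `(λ_2-1, …, λ_i-1, j, λ_{i+1}, …, λ_k)`
    fun p =>
      if 1 ≤ p ∧ p + 1 ≤ i then lam (p+1) - 1
      else if p = i ∧ 1 ≤ p ∧ p ≤ k then (j:ℤ)
      else if i + 1 ≤ p ∧ p ≤ k then lam p
      else 0

/-- `λ^{O_Y(d)} = (λ^{O_Y(1)})^{O∘(d-1)}`. -/
def OYd (n k m : ℕ) (lam : ℕ → ℤ) (d : ℕ) : ℕ → ℤ := OcD k (OY1 n k m lam) (d-1)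

open scoped Classical in
/-- `α^{O_Z(1)}` for `α ∈ BKT(k, 2n+1)` with `α_1 = 2n+1-k`. -/
def OZ1bkt (n k : ℕ) (α : ℕ → ℤ) : ℕ → ℤ :=
  if ∃ j, 3 ≤ j ∧ j ≤ k ∧ α 2 + α j ≤ 2*((n:ℤ)-k)+j-2 then
    -- `j0` minimal such that `α_2 + α_{j0} ≤ 2(n-k)+j0-2`
    let j0 := sInf {j | 3 ≤ j ∧ j ≤ k ∧ α 2 + α j ≤ 2*((n:ℤ)-k)+j-2}
    fun p =>
      if p = 1 then α 1
      else if 2 ≤ p ∧ p + 2 ≤ j0 then α (p+1)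
      else if j0 ≤ p + 1 ∧ p + 1 ≤ k then max (α (p+1) - 1) (-1)
      else if p = k then -1 else 0
  else
    fun p =>
      if p = 1 then α 1
      else if 2 ≤ p ∧ p + 1 ≤ k then α (p+1)
      else if p = k then -1 else 0

/-- `α^{O_Z(d)}`. -/
def OZdbkt (n k : ℕ) (α : ℕ → ℤ) : ℕ → ℕ → ℤ
  | 0 => α
  | d+1 => OZ1bkt n k (OZdbkt n k α d)

/-- `Comp_BKT(d)`. -/
def CompBKT (n k d : ℕ) (α : ℕ → ℤ) : Prop :=
  IsBKTodd n k α ∧ α 1 = 2*(n:ℤ)+1-k ∧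
  (OZdbkt n k α (d-1)) 2 - (elld k (OZdbkt n k α (d-1)) (-1) 2 : ℤ) = 2*((n:ℤ)+1-k)

/-- `ℓ_{-1}(α) = max {j : α_j > -1}`. -/
def ellNeg (k : ℕ) (α : ℕ → ℤ) : ℕ :=
  ((Finset.Icc 1 k).filter (fun j => (-1:ℤ) < α j)).sup id

/-- `α^{O_Y(1)} = (α_2, …, α_{ℓ_{-1}(α)}, 0, …, 0)` for `α ∈ BKT(k, 2n+1)` with
`α_1 = 2n+1-k`. -/
def OY1bkt (k : ℕ) (α : ℕ → ℤ) (j : ℕ) : ℤ :=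
  if 1 ≤ j ∧ j + 1 ≤ ellNeg k α then α (j+1) else 0

/-! ### Correspondences between partitions and Weyl group elements -/

/-- The 01-word correspondence between `μ ∈ BC(k, 2n+2)` and `w ∈ W^P`: for a 1-indexed
value `a ∈ {1, …, n+1}`, `a` occurs among the first `k` values of `w` iff `D(μ)(a) = 1`,
and `bar a` occurs iff `D(μ)(2n+3-a) = 1`. -/
def BCrel (n k : ℕ) (μ : ℕ → ℤ) (w : Equiv.Perm (Fin (2*n+2))) : Prop :=
  ∀ i, 1 ≤ i → i ≤ n+1 →
    ((fn n (i-1) ∈ valSet n k w) ↔ Dword k (2*n+2) μ i) ∧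
    ((fn n (2*n+2-i) ∈ valSet n k w) ↔ Dword k (2*n+2) μ (2*n+3-i))

/-- The BKT correspondence between `β ∈ BKT(k, 2n+2)` and `w ∈ W^P`:
`β_j = 2n+3-k-w(j) + #{i < j : w(i)+w(j) > 2n+3}` (1-indexed values). -/
def BKTrel (n k : ℕ) (β : ℕ → ℤ) (w : Equiv.Perm (Fin (2*n+2))) : Prop :=
  ∀ j, 1 ≤ j → j ≤ k →
    β j = 2*(n:ℤ)+3-k - ((w (fn n (j-1)) : ℕ) + 1) +
      (((Finset.Icc 1 (j-1)).filter
        (fun i => 2*n+1 < (w (fn n (i-1)) : ℕ) + (w (fn n (j-1)) : ℕ))).card : ℤ)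

/-! ### Signed permutations through their values -/

/-- The value of `w` at position `j`, as a natural number. -/
def ev (m : ℕ) (w : Equiv.Perm (Fin (2*m+2))) (j : ℕ) : ℕ := (w (fn m j) : ℕ)

lemma fn_val {m j : ℕ} (h : j < 2*m+2) : ((fn m j : Fin (2*m+2)) : ℕ) = j :=
  Nat.mod_eq_of_lt h

@[simp] lemma fn_coe {m : ℕ} (x : Fin (2*m+2)) : fn m (x : ℕ) = x :=
  Fin.ext (fn_val x.isLt)

lemma fn_inj {m i j : ℕ} (hi : i < 2*m+2) (hj : j < 2*m+2) : fn m i = fn m j ↔ i = j := by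
  rw [Fin.ext_iff, fn_val hi, fn_val hj]

lemma coe_apply {m : ℕ} (w : Equiv.Perm (Fin (2*m+2))) (x : Fin (2*m+2)) :
    (w x : ℕ) = ev m w x := by
  simp [ev]

lemma fn_ev {m : ℕ} (w : Equiv.Perm (Fin (2*m+2))) (j : ℕ) : fn m (ev m w j) = w (fn m j) := by
  simp [ev]

lemma ev_lt {m : ℕ} (w : Equiv.Perm (Fin (2*m+2))) (j : ℕ) : ev m w j < 2*m+2 :=
  (w (fn m j)).isLt

lemma ev_mul {m : ℕ} (u v : Equiv.Perm (Fin (2*m+2))) (j : ℕ) :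
    ev m (u * v) j = ev m u (ev m v j) := by
  simp [ev]

lemma ev_one {m j : ℕ} (h : j < 2*m+2) : ev m 1 j = j := by
  simp [ev, fn_val h]

lemma ev_inj {m : ℕ} (w : Equiv.Perm (Fin (2*m+2))) {i j : ℕ} (hi : i < 2*m+2)
    (hj : j < 2*m+2) : ev m w i = ev m w j ↔ i = j := by
  simp only [ev, ← Fin.ext_iff, w.injective.eq_iff, fn_inj hi hj]

lemma ev_inv_ev {m : ℕ} (w : Equiv.Perm (Fin (2*m+2))) {j : ℕ} (hj : j < 2*m+2) :
    ev m w⁻¹ (ev m w j) = j := by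
  rw [← ev_mul, inv_mul_cancel, ev_one hj]

lemma ev_ev_inv {m : ℕ} (w : Equiv.Perm (Fin (2*m+2))) {j : ℕ} (hj : j < 2*m+2) :
    ev m w (ev m w⁻¹ j) = j := by
  rw [← ev_mul, mul_inv_cancel, ev_one hj]

lemma ext_ev {m : ℕ} {u v : Equiv.Perm (Fin (2*m+2))}
    (h : ∀ j < 2*m+2, ev m u j = ev m v j) : u = v := by
  ext x
  rw [coe_apply, coe_apply, h _ x.isLt]

lemma ev_swap {m a b j : ℕ} (ha : a < 2*m+2) (hb : b < 2*m+2) (hj : j < 2*m+2) :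
    ev m (swap (fn m a) (fn m b)) j = if j = a then b else if j = b then a else j := by
  simp only [ev, swap_apply_def, fn_inj hj ha, fn_inj hj hb]
  split_ifs <;> simp [fn_val, *]

lemma ev_sRefl {m i j : ℕ} (h1 : 1 ≤ i) (h2 : i ≤ m) (hj : j < 2*m+2) :
    ev m (sRefl m i) j = if j = i-1 then i else if j = i then i-1 else
      if j = 2*m+2-i then 2*m+1-i else if j = 2*m+1-i then 2*m+2-i else j := by
  rw [sRefl, if_pos h2, ev_mul, ev_swap (by omega) (by omega) (ev_lt _ _),
    ev_swap (by omega) (by omega) hj]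
  split_ifs <;> omega

lemma ev_sRefl_last {m j : ℕ} (hj : j < 2*m+2) :
    ev m (sRefl m (m+1)) j = if j = m then m+1 else if j = m+1 then m else j := by
  rw [sRefl, if_neg (by omega), ev_swap (by omega) (by omega) hj]

lemma sRefl_mul_self {m i : ℕ} (h1 : 1 ≤ i) (h2 : i ≤ m+1) : sRefl m i * sRefl m i = 1 := by
  apply ext_ev
  intro j hj
  rw [ev_mul, ev_one hj]
  rcases Nat.lt_or_ge m i with h | h
  · obtain rfl : i = m+1 := by omega
    rw [ev_sRefl_last (ev_lt _ _), ev_sRefl_last hj]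
    split_ifs <;> omega
  · rw [ev_sRefl h1 h (ev_lt _ _), ev_sRefl h1 h hj]
    split_ifs <;> omega

lemma sRefl_inv {m i : ℕ} (h1 : 1 ≤ i) (h2 : i ≤ m+1) : (sRefl m i)⁻¹ = sRefl m i :=
  inv_eq_of_mul_eq_one_left (sRefl_mul_self h1 h2)

lemma mem_Weyl {m : ℕ} {w : Equiv.Perm (Fin (2*m+2))} :
    w ∈ Weyl m ↔ ∀ j < 2*m+2, ev m w (2*m+1-j) = 2*m+1 - ev m w j := by
  rw [Weyl, Subgroup.mem_centralizer_singleton_iff]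
  have hb : ∀ j < 2*m+2, ev m (barPerm m) j = 2*m+1-j := fun j hj => by
    change ((bar m (fn m j)) : ℕ) = _
    simp [bar, fn_val hj]
  constructor
  · intro h j hj
    have := congrArg (fun x => ev m x j) h
    simp only [ev_mul] at this
    rw [hb _ hj, hb _ (ev_lt _ _)] at this
    omega
  · intro h
    apply ext_ev
    intro j hj
    rw [ev_mul, ev_mul, hb _ hj, hb _ (ev_lt _ _), h j hj]

lemma ev_bar {m : ℕ} {w : Equiv.Perm (Fin (2*m+2))} (hw : w ∈ Weyl m) {i j : ℕ}
    (h : i + j = 2*m+1) : ev m w i + ev m w j = 2*m+1 := by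
  have h1 := mem_Weyl.1 hw j (by omega)
  have h2 := ev_lt w j
  rw [show 2*m+1-j = i by omega] at h1
  omega

lemma sRefl_mem_Weyl {m i : ℕ} (h1 : 1 ≤ i) (h2 : i ≤ m+1) : sRefl m i ∈ Weyl m := by
  rw [mem_Weyl]
  intro j hj
  rcases Nat.lt_or_ge m i with h | h
  · obtain rfl : i = m+1 := by omega
    rw [ev_sRefl_last (by omega), ev_sRefl_last hj]
    split_ifs <;> omega
  · rw [ev_sRefl h1 h (by omega), ev_sRefl h1 h hj]
    split_ifs <;> omega

lemma ext_ev_Weyl {m : ℕ} {u v : Equiv.Perm (Fin (2*m+2))} (hu : u ∈ Weyl m) (hv : v ∈ Weyl m)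
    (h : ∀ j ≤ m, ev m u j = ev m v j) : u = v := by
  apply ext_ev
  intro j hj
  rcases Nat.lt_or_ge m j with hmj | hmj
  · have h1 := ev_bar hu (i := j) (j := 2*m+1-j) (by omega)
    have h2 := ev_bar hv (i := j) (j := 2*m+1-j) (by omega)
    have h3 := h (2*m+1-j) (by omega)
    omega
  · exact h j hmj

/-! ### Length and inversions -/

/-- `w` increases at the simple reflection `s_i`. -/
def Asc (m : ℕ) (w : Equiv.Perm (Fin (2*m+2))) (i : ℕ) : Prop := ev m w (i-1) < ev m w i

/-- The inversions of a permutation of `Fin N`. -/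
def invSet {N : ℕ} (w : Equiv.Perm (Fin N)) : Finset (Fin N × Fin N) :=
  Finset.univ.filter fun p => p.1 < p.2 ∧ w p.2 < w p.1

lemma mem_invSet {N : ℕ} {w : Equiv.Perm (Fin N)} {x y : Fin N} :
    (x, y) ∈ invSet w ↔ x < y ∧ w y < w x := by
  simp [invSet]

lemma card_invSet_mul_swap {N : ℕ} (w : Equiv.Perm (Fin N)) (a b : Fin N)
    (hab : (a : ℕ) + 1 = b) (h : w a < w b) :
    (invSet (w * swap a b)).card = (invSet w).card + 1 := by
  have key : invSet (w * swap a b) =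
      insert (a, b) ((invSet w).map ((swap a b).prodCongr (swap a b)).toEmbedding) := by
    ext ⟨x, y⟩
    rw [Finset.mem_insert, Finset.mem_map_equiv]
    simp only [mem_invSet, Perm.mul_apply, Equiv.prodCongr_symm, symm_swap, Equiv.prodCongr_apply,
      Prod.map_apply, Prod.mk.injEq]
    rw [swap_apply_def, swap_apply_def]
    rw [Fin.lt_def] at h
    split_ifs <;> subst_vars <;>
      simp only [Fin.lt_def, Fin.ext_iff, and_self, true_or, iff_true] at * <;> omega
  rw [key, Finset.card_insert_of_notMem, Finset.card_map]
  rw [Finset.mem_map_equiv]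
  simp only [mem_invSet, Equiv.prodCongr_symm, symm_swap, Equiv.prodCongr_apply,
    Prod.map_apply, swap_apply_left, swap_apply_right, Fin.lt_def]
  omega

/-- The number of barred entries in positions `0, …, m`. -/
def negCount (m : ℕ) (w : Equiv.Perm (Fin (2*m+2))) : ℕ :=
  ((Finset.range (m+1)).filter fun j => m < ev m w j).card

/-- Twice the length, in terms of inversions. -/
def invLen (m : ℕ) (w : Equiv.Perm (Fin (2*m+2))) : ℕ := (invSet w).card + negCount m w

lemma invLen_mul_sRefl_of_asc {m i : ℕ} {w : Equiv.Perm (Fin (2*m+2))} (hw : w ∈ Weyl m)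
    (h1 : 1 ≤ i) (h2 : i ≤ m+1) (h : Asc m w i) :
    invLen m (w * sRefl m i) = invLen m w + 2 := by
  unfold Asc at h
  rcases Nat.lt_or_ge m i with hi | hi
  · obtain rfl : i = m+1 := by omega
    have hbar := ev_bar hw (i := m) (j := m+1) (by omega)
    simp only [Nat.add_sub_cancel] at h
    have e1 : (invSet (w * sRefl m (m+1))).card = (invSet w).card + 1 := by
      rw [sRefl, if_neg (by omega)]
      apply card_invSet_mul_swap
      · rw [fn_val (by omega), fn_val (by omega)]
      · exact h
    have e2 : negCount m (w * sRefl m (m+1)) = negCount m w + 1 := by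
      unfold negCount
      rw [Finset.range_add_one, Finset.filter_insert, Finset.filter_insert, if_pos, if_neg,
        Finset.card_insert_of_notMem]
      · congr 2
        apply Finset.filter_congr
        intro j hj
        have := Finset.mem_range.1 hj
        rw [ev_mul, ev_sRefl_last (by omega), if_neg (by omega), if_neg (by omega)]
      · simp
      · omega
      · rw [ev_mul, ev_sRefl_last (by omega), if_pos rfl]
        omega
    unfold invLen
    omega
  · have e1 : (invSet (w * sRefl m i)).card = (invSet w).card + 2 := by
      rw [sRefl, if_pos hi, swap_comm (fn m (2*m+2-i)), ← mul_assoc, card_invSet_mul_swap,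
        card_invSet_mul_swap]
      · rw [fn_val (by omega), fn_val (by omega)]; omega
      · exact h
      · rw [fn_val (by omega), fn_val (by omega)]; omega
      · rw [Fin.lt_def]
        change ev m (w * swap _ _) _ < ev m (w * swap _ _) _
        have hb1 := ev_bar hw (i := i) (j := 2*m+1-i) (by omega)
        have hb2 := ev_bar hw (i := i-1) (j := 2*m+2-i) (by omega)
        rw [ev_mul, ev_mul, ev_swap (by omega) (by omega) (by omega),
          ev_swap (by omega) (by omega) (by omega), if_neg (by omega), if_neg (by omega),
          if_neg (by omega), if_neg (by omega)]
        omega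
    have e2 : negCount m (w * sRefl m i) = negCount m w := by
      unfold negCount
      have hs : ∀ j ≤ m, ev m (sRefl m i) j ≤ m := by
        intro j hj
        rw [ev_sRefl h1 hi (by omega)]
        split_ifs <;> omega
      have hss : ∀ j ≤ m, ev m (sRefl m i) (ev m (sRefl m i) j) = j := by
        intro j hj
        rw [← ev_mul, sRefl_mul_self h1 h2, ev_one (by omega)]
      apply Finset.card_nbij' (ev m (sRefl m i)) (ev m (sRefl m i))
      · intro j hj
        simp only [Finset.coe_filter, Finset.mem_range, Set.mem_ofPred_eq, ev_mul] at hj ⊢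
        exact ⟨by have := hs j (by omega); omega, hj.2⟩
      · intro j hj
        simp only [Finset.coe_filter, Finset.mem_range, Set.mem_ofPred_eq, ev_mul] at hj ⊢
        exact ⟨by have := hs j (by omega); omega, by rw [hss _ (by omega)]; exact hj.2⟩
      · intro j hj
        simp only [Finset.coe_filter, Finset.mem_range, Set.mem_ofPred_eq] at hj
        exact hss j (by omega)
      · intro j hj
        simp only [Finset.coe_filter, Finset.mem_range, Set.mem_ofPred_eq] at hj
        exact hss j (by omega)
    unfold invLen
    omega

lemma ev_mul_sRefl_left {m i : ℕ} (w : Equiv.Perm (Fin (2*m+2))) (h1 : 1 ≤ i) (h2 : i ≤ m+1) :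
    ev m (w * sRefl m i) (i-1) = ev m w i := by
  rw [ev_mul]
  rcases Nat.lt_or_ge m i with hi | hi
  · obtain rfl : i = m+1 := by omega
    rw [ev_sRefl_last (by omega), if_pos (by omega)]
  · rw [ev_sRefl h1 hi (by omega), if_pos rfl]

lemma ev_mul_sRefl_right {m i : ℕ} (w : Equiv.Perm (Fin (2*m+2))) (h1 : 1 ≤ i) (h2 : i ≤ m+1) :
    ev m (w * sRefl m i) i = ev m w (i-1) := by
  rw [ev_mul]
  rcases Nat.lt_or_ge m i with hi | hi
  · obtain rfl : i = m+1 := by omega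
    rw [ev_sRefl_last (by omega), if_neg (by omega), if_pos rfl]; rfl
  · rw [ev_sRefl h1 hi (by omega), if_neg (by omega), if_pos rfl]

lemma asc_mul_sRefl {m i : ℕ} {w : Equiv.Perm (Fin (2*m+2))} (h1 : 1 ≤ i) (h2 : i ≤ m+1) :
    Asc m (w * sRefl m i) i ↔ ¬ Asc m w i := by
  unfold Asc
  rw [ev_mul_sRefl_left w h1 h2, ev_mul_sRefl_right w h1 h2]
  have := (ev_inj w (i := i-1) (j := i) (by omega) (by omega)).not.2 (by omega)
  omega

lemma invLen_of_not_asc {m i : ℕ} {w : Equiv.Perm (Fin (2*m+2))} (hw : w ∈ Weyl m)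
    (h1 : 1 ≤ i) (h2 : i ≤ m+1) (h : ¬ Asc m w i) :
    invLen m w = invLen m (w * sRefl m i) + 2 := by
  have := invLen_mul_sRefl_of_asc (mul_mem hw (sRefl_mem_Weyl h1 h2)) h1 h2
    ((asc_mul_sRefl h1 h2).2 h)
  rwa [mul_assoc, sRefl_mul_self h1 h2, mul_one] at this

lemma invLen_one (m : ℕ) : invLen m 1 = 0 := by
  unfold invLen negCount invSet
  rw [Nat.add_eq_zero_iff]
  constructor
  · rw [Finset.card_eq_zero, Finset.filter_eq_empty_iff]
    rintro ⟨x, y⟩ -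
    simp only [Perm.coe_one, id]
    omega
  · rw [Finset.card_eq_zero, Finset.filter_eq_empty_iff]
    intro x hx
    rw [Finset.mem_range] at hx
    rw [ev_one (by omega)]
    omega

/-! ### Sorted representatives -/

/-- `w` has no descents away from position `kk`. -/
def Sorted (m kk : ℕ) (w : Equiv.Perm (Fin (2*m+2))) : Prop :=
  ∀ i, 1 ≤ i → i ≤ m+1 → i ≠ kk → Asc m w i

lemma eq_of_strictMono_of_image {f g : ℕ → ℕ} {a b : ℕ}
    (hf : ∀ i j, a ≤ i → i < j → j < b → f i < f j) (hg : ∀ i j, a ≤ i → i < j → j < b → g i < g j)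
    (hfg : ∀ i, a ≤ i → i < b → ∃ j, a ≤ j ∧ j < b ∧ g j = f i)
    (hgf : ∀ i, a ≤ i → i < b → ∃ j, a ≤ j ∧ j < b ∧ f j = g i) :
    ∀ j, a ≤ j → j < b → f j = g j := by
  intro j
  induction j using Nat.strong_induction_on with
  | _ j ih =>
    intro haj hjb
    obtain ⟨x, hx1, hx2, hx3⟩ := hfg j haj hjb
    obtain ⟨y, hy1, hy2, hy3⟩ := hgf j haj hjb
    have hx : j ≤ x := by
      by_contra hlt
      have := ih x (by omega) hx1 hx2
      have := hf x j hx1 (by omega) hjb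
      omega
    have hy : j ≤ y := by
      by_contra hlt
      have := ih y (by omega) hy1 hy2
      have := hg y j hy1 (by omega) hjb
      omega
    have h1 : g j ≤ g x := by
      rcases hx.eq_or_lt with rfl | h
      · rfl
      · exact (hg j x haj h hx2).le
    have h2 : f j ≤ f y := by
      rcases hy.eq_or_lt with rfl | h
      · rfl
      · exact (hf j y haj h hy2).le
    omega

lemma strictMono_of_asc {m a b : ℕ} {w : Equiv.Perm (Fin (2*m+2))}
    (h : ∀ i, a < i → i < b → Asc m w i) :
    ∀ i j, a ≤ i → i < j → j < b → ev m w i < ev m w j := by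
  intro i j hi hij
  induction j, hij using Nat.le_induction with
  | base => intro hb; exact h (i+1) (by omega) hb
  | succ j hj ih =>
    intro hb
    have h1 := h (j+1) (by omega) hb
    unfold Asc at h1
    rw [Nat.add_sub_cancel] at h1
    exact (ih (by omega)).trans h1

namespace Sorted

variable {m kk : ℕ} {w : Equiv.Perm (Fin (2*m+2))}

lemma lt_low (h : Sorted m kk w) (hk : kk ≤ m) {i j : ℕ} (hij : i < j) (hj : j < kk) :
    ev m w i < ev m w j :=
  strictMono_of_asc (a := 0) (b := kk)
    (fun i h1 h2 => h i (by omega) (by omega) (by omega)) i j (by omega) hij hj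

lemma lt_high (h : Sorted m kk w) {i j : ℕ} (hi : kk ≤ i) (hij : i < j) (hj : j ≤ m + 1) :
    ev m w i < ev m w j :=
  strictMono_of_asc (a := kk) (b := m+2)
    (fun i h1 h2 => h i (by omega) (by omega) (by omega)) i j hi hij (by omega)

lemma high_le (h : Sorted m kk w) (hw : w ∈ Weyl m) {j : ℕ} (hj : kk ≤ j) (hjm : j ≤ m) :
    ev m w j ≤ m := by
  have h1 := h.lt_high (i := m) (j := m+1) (by omega) (by omega) le_rfl
  have h2 := ev_bar hw (i := m) (j := m+1) (by omega)
  rcases hjm.eq_or_lt with rfl | hlt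
  · omega
  · have := h.lt_high hj hlt (by omega)
    omega

end Sorted

lemma mem_valSet {m kk : ℕ} {w : Equiv.Perm (Fin (2*m+2))} {x : ℕ} (hk : kk ≤ m)
    (hx : x < 2*m+2) : fn m x ∈ valSet m kk w ↔ ∃ j < kk, ev m w j = x := by
  unfold valSet
  rw [Finset.mem_image]
  constructor
  · rintro ⟨j, hj, hjx⟩
    refine ⟨j, (Finset.mem_filter.1 hj).2, ?_⟩
    rw [← coe_apply, hjx, fn_val hx]
  · rintro ⟨j, hj, hjx⟩
    refine ⟨fn m j, ?_, ?_⟩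
    · simp [fn_val (show j < 2*m+2 by omega), hj]
    · rw [← fn_ev, hjx]

lemma Sorted.exists_high_iff {m kk : ℕ} {w : Equiv.Perm (Fin (2*m+2))} (h : Sorted m kk w)
    (hw : w ∈ Weyl m) (hk : kk ≤ m) {x : ℕ} (hx : x < 2*m+2) :
    (∃ j, kk ≤ j ∧ j < m+1 ∧ ev m w j = x) ↔
      x ≤ m ∧ fn m x ∉ valSet m kk w ∧ fn m (2*m+1-x) ∉ valSet m kk w := by
  rw [mem_valSet hk hx, mem_valSet hk (by omega)]
  constructor
  · rintro ⟨j, hj1, hj2, rfl⟩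
    refine ⟨h.high_le hw hj1 (by omega), ?_, ?_⟩
    · rintro ⟨i, hi, hij⟩
      rw [ev_inj w (by omega) (by omega)] at hij
      omega
    · rintro ⟨i, hi, hij⟩
      have := ev_bar hw (i := i) (j := 2*m+1-i) (by omega)
      have h2 := (ev_inj w (i := j) (j := 2*m+1-i) (by omega) (by omega)).1 (by omega)
      omega
  · rintro ⟨hxm, hx1, hx2⟩
    have hj := ev_lt w⁻¹ x
    have hjx := ev_ev_inv w hx
    have hj1 : kk ≤ ev m w⁻¹ x := by
      by_contra hlt
      exact hx1 ⟨_, by omega, hjx⟩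
    have hb := ev_bar hw (i := ev m w⁻¹ x) (j := 2*m+1-ev m w⁻¹ x) (by omega)
    refine ⟨_, hj1, ?_, hjx⟩
    by_contra hlt
    rcases Nat.lt_or_ge (2*m+1-ev m w⁻¹ x) kk with h3 | h3
    · exact hx2 ⟨_, h3, by omega⟩
    · have := h.high_le hw h3 (by omega)
      omega

lemma Sorted.eq_of_valSet_eq {m kk : ℕ} {u v : Equiv.Perm (Fin (2*m+2))} (hk : kk ≤ m)
    (hu : u ∈ Weyl m) (hv : v ∈ Weyl m) (su : Sorted m kk u) (sv : Sorted m kk v)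
    (h : valSet m kk u = valSet m kk v) : u = v := by
  apply ext_ev_Weyl hu hv
  intro j hj
  rcases Nat.lt_or_ge j kk with hjk | hjk
  · refine eq_of_strictMono_of_image (a := 0) (b := kk) (fun i j _ hij hj => su.lt_low hk hij hj)
      (fun i j _ hij hj => sv.lt_low hk hij hj) ?_ ?_ j (Nat.zero_le _) hjk
    · intro i _ hi
      have := (mem_valSet (w := u) hk (ev_lt u i)).2 ⟨i, hi, rfl⟩
      rw [h, mem_valSet hk (ev_lt u i)] at this
      obtain ⟨j, h1, h2⟩ := this
      exact ⟨j, by omega, h1, h2⟩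
    · intro i _ hi
      have := (mem_valSet (w := v) hk (ev_lt v i)).2 ⟨i, hi, rfl⟩
      rw [← h, mem_valSet hk (ev_lt v i)] at this
      obtain ⟨j, h1, h2⟩ := this
      exact ⟨j, by omega, h1, h2⟩
  · refine eq_of_strictMono_of_image (a := kk) (b := m+1)
      (fun i j h1 hij hj => su.lt_high h1 hij (by omega))
      (fun i j h1 hij hj => sv.lt_high h1 hij (by omega)) ?_ ?_ j hjk (by omega)
    · intro i h1 h2
      have := (su.exists_high_iff hu hk (ev_lt u i)).1 ⟨i, h1, h2, rfl⟩
      rw [h] at this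
      exact (sv.exists_high_iff hv hk (ev_lt u i)).2 this
    · intro i h1 h2
      have := (sv.exists_high_iff hv hk (ev_lt v i)).1 ⟨i, h1, h2, rfl⟩
      rw [← h] at this
      exact (su.exists_high_iff hu hk (ev_lt v i)).2 this

lemma prod_mem_Weyl {m : ℕ} {l : List ℕ} (h : ∀ i ∈ l, 1 ≤ i ∧ i ≤ m+1) :
    (l.map (sRefl m)).prod ∈ Weyl m := by
  apply Subgroup.list_prod_mem
  intro x hx
  obtain ⟨i, hi, rfl⟩ := List.mem_map.1 hx
  exact sRefl_mem_Weyl (h i hi).1 (h i hi).2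

lemma inv_prod_sRefl {m : ℕ} {l : List ℕ} (h : ∀ i ∈ l, 1 ≤ i ∧ i ≤ m+1) :
    ((l.map (sRefl m)).prod)⁻¹ = (l.reverse.map (sRefl m)).prod := by
  induction l with
  | nil => simp
  | cons i l ih =>
    have hi := h i (by simp)
    rw [List.map_cons, List.prod_cons, mul_inv_rev, ih fun j hj => h j (by simp [hj]),
      List.reverse_cons, List.map_append, List.prod_append, sRefl_inv hi.1 hi.2]
    simp

lemma invLen_prod_le {m : ℕ} {l : List ℕ} (h : ∀ i ∈ l, 1 ≤ i ∧ i ≤ m+1) :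
    invLen m (l.map (sRefl m)).prod ≤ 2 * l.length := by
  induction l using List.reverseRecOn with
  | nil => simp [invLen_one]
  | append_singleton l i ih =>
    have hi := h i (by simp)
    have hl : ∀ j ∈ l, 1 ≤ j ∧ j ≤ m+1 := fun j hj => h j (by simp [hj])
    have h1 := ih hl
    simp only [List.map_append, List.map_cons, List.map_nil, List.prod_append, List.prod_cons,
      List.prod_nil, mul_one, List.length_append, List.length_singleton]
    by_cases ha : Asc m (l.map (sRefl m)).prod i
    · rw [invLen_mul_sRefl_of_asc (prod_mem_Weyl hl) hi.1 hi.2 ha]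
      omega
    · have := invLen_of_not_asc (prod_mem_Weyl hl) hi.1 hi.2 ha
      omega

lemma exists_sorted_mul_prod {m : ℕ} (kk : ℕ) {w : Equiv.Perm (Fin (2*m+2))} (hw : w ∈ Weyl m) :
    ∃ l : List ℕ, (∀ i ∈ l, (1 ≤ i ∧ i ≤ m+1) ∧ i ≠ kk) ∧
      Sorted m kk (w * (l.map (sRefl m)).prod) ∧
      invLen m w = invLen m (w * (l.map (sRefl m)).prod) + 2 * l.length := by
  induction hN : invLen m w using Nat.strong_induction_on generalizing w with
  | _ N ih =>
    by_cases hs : Sorted m kk w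
    · exact ⟨[], by simp, by simpa using hs, by simp [hN]⟩
    · unfold Sorted at hs
      push Not at hs
      obtain ⟨i, h1, h2, h3, h4⟩ := hs
      have hlen := invLen_of_not_asc hw h1 h2 h4
      obtain ⟨l, hl1, hl2, hl3⟩ := ih _ (by omega) (mul_mem hw (sRefl_mem_Weyl h1 h2)) rfl
      refine ⟨i :: l, ?_, ?_, ?_⟩
      · intro j hj
        rcases List.mem_cons.1 hj with rfl | hj
        · exact ⟨⟨h1, h2⟩, h3⟩
        · exact hl1 j hj
      · rwa [List.map_cons, List.prod_cons, ← mul_assoc]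
      · rw [List.map_cons, List.prod_cons, ← mul_assoc, List.length_cons]
        omega

lemma sorted_one (m kk : ℕ) : Sorted m kk 1 := by
  intro i h1 h2 _
  unfold Asc
  rw [ev_one (by omega), ev_one (by omega)]
  omega

lemma two_mul_len {m : ℕ} {w : Equiv.Perm (Fin (2*m+2))} (hw : w ∈ Weyl m) :
    2 * len m w = invLen m w := by
  obtain ⟨l, hl1, hl2, hl3⟩ := exists_sorted_mul_prod 0 hw
  have hl : ∀ i ∈ l, 1 ≤ i ∧ i ≤ m+1 := fun i hi => (hl1 i hi).1
  have h1 : w * (l.map (sRefl m)).prod = 1 :=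
    hl2.eq_of_valSet_eq (Nat.zero_le _) (mul_mem hw (prod_mem_Weyl hl)) (one_mem _)
      (sorted_one m 0) (by simp [valSet])
  rw [h1, invLen_one] at hl3
  have hw' : (l.reverse.map (sRefl m)).prod = w := by
    rw [← inv_prod_sRefl hl, eq_comm, ← mul_eq_one_iff_eq_inv, h1]
  have hmem : l.length ∈ {r | ∃ l : List ℕ, l.length = r ∧ (∀ i ∈ l, 1 ≤ i ∧ i ≤ m+1) ∧
      (l.map (sRefl m)).prod = w} :=
    ⟨l.reverse, by simp, fun i hi => hl i (by simpa using hi), hw'⟩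
  have hle : len m w ≤ l.length := Nat.sInf_le hmem
  obtain ⟨l', h2, h3, h4⟩ := Nat.sInf_mem (⟨_, hmem⟩ : Set.Nonempty _)
  have := invLen_prod_le h3
  rw [h4] at this
  change l'.length = len m w at h2
  omega

section Length

variable {m i : ℕ} {w : Equiv.Perm (Fin (2*m+2))}

lemma len_mul_sRefl_of_asc (hw : w ∈ Weyl m) (h1 : 1 ≤ i) (h2 : i ≤ m+1) (h : Asc m w i) :
    len m (w * sRefl m i) = len m w + 1 := by
  have e1 := two_mul_len hw
  have e2 := two_mul_len (mul_mem hw (sRefl_mem_Weyl h1 h2))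
  have e3 := invLen_mul_sRefl_of_asc hw h1 h2 h
  omega

lemma len_of_not_asc (hw : w ∈ Weyl m) (h1 : 1 ≤ i) (h2 : i ≤ m+1) (h : ¬ Asc m w i) :
    len m w = len m (w * sRefl m i) + 1 := by
  have e1 := two_mul_len hw
  have e2 := two_mul_len (mul_mem hw (sRefl_mem_Weyl h1 h2))
  have e3 := invLen_of_not_asc hw h1 h2 h
  omega

lemma len_lt_len_mul_sRefl_iff (hw : w ∈ Weyl m) (h1 : 1 ≤ i) (h2 : i ≤ m+1) :
    len m w < len m (w * sRefl m i) ↔ Asc m w i := by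
  by_cases h : Asc m w i
  · have := len_mul_sRefl_of_asc hw h1 h2 h
    simp only [h, iff_true]
    omega
  · have := len_of_not_asc hw h1 h2 h
    simp only [h, iff_false]
    omega

lemma len_inv (w : Equiv.Perm (Fin (2*m+2))) : len m w⁻¹ = len m w := by
  unfold len
  congr 1
  have key : ∀ (x : Equiv.Perm (Fin (2*m+2))) (r : ℕ),
      (∃ l : List ℕ, l.length = r ∧ (∀ i ∈ l, 1 ≤ i ∧ i ≤ m+1) ∧ (l.map (sRefl m)).prod = x) →
      ∃ l : List ℕ, l.length = r ∧ (∀ i ∈ l, 1 ≤ i ∧ i ≤ m+1) ∧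
        (l.map (sRefl m)).prod = x⁻¹ := by
    rintro x r ⟨l, h1, h2, h3⟩
    exact ⟨l.reverse, by simpa using h1, fun i hi => h2 i (by simpa using hi),
      by rw [← inv_prod_sRefl h2, h3]⟩
  ext r
  exact ⟨fun h => by simpa using key _ _ h, fun h => key _ _ h⟩

end Length

/-! ### Cosets of the parabolic subgroup -/

section Cosets

variable {m kk : ℕ}

lemma WP_le_Weyl : WP m kk ≤ Weyl m := by
  unfold WP
  rw [Subgroup.closure_le]
  rintro _ ⟨i, h1, h2, -, rfl⟩
  exact sRefl_mem_Weyl h1 h2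

lemma sRefl_mem_WP {i : ℕ} (h1 : 1 ≤ i) (h2 : i ≤ m+1) (h3 : i ≠ kk) : sRefl m i ∈ WP m kk :=
  Subgroup.subset_closure ⟨i, h1, h2, h3, rfl⟩

lemma isMinRep.sorted {w : Equiv.Perm (Fin (2*m+2))} (h : isMinRep m kk w) : Sorted m kk w := by
  intro i h1 h2 h3
  by_contra hc
  have e1 := len_of_not_asc h.1 h1 h2 hc
  have e2 := h.2 _ (sRefl_mem_WP h1 h2 h3)
  omega

lemma exists_isMinRep {w : Equiv.Perm (Fin (2*m+2))} (hw : w ∈ Weyl m) :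
    ∃ v, isMinRep m kk v ∧ cosetEq m kk v w := by
  obtain ⟨v, ⟨p, hp, rfl⟩, hmin⟩ := WellFounded.has_min (measure (len m)).wf
    {v | ∃ p ∈ WP m kk, v = w * p} ⟨w, 1, one_mem _, by simp⟩
  refine ⟨w * p, ⟨mul_mem hw (WP_le_Weyl hp), fun q hq => ?_⟩, ?_⟩
  · have := hmin (w * p * q) ⟨p * q, mul_mem hp hq, by rw [mul_assoc]⟩
    exact not_lt.1 this
  · unfold cosetEq
    rw [mul_inv_rev, mul_assoc, inv_mul_cancel, mul_one]
    exact inv_mem hp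

lemma ev_lt_iff_of_mem_WP (hk : kk ≤ m) {p : Equiv.Perm (Fin (2*m+2))} (hp : p ∈ WP m kk) :
    ∀ j < 2*m+2, (ev m p j < kk ↔ j < kk) := by
  unfold WP at hp
  induction hp using Subgroup.closure_induction with
  | mem x hx =>
    obtain ⟨i, h1, h2, h3, rfl⟩ := hx
    intro j hj
    rcases Nat.lt_or_ge m i with hi | hi
    · obtain rfl : i = m+1 := by omega
      rw [ev_sRefl_last hj]
      split_ifs <;> omega
    · rw [ev_sRefl h1 hi hj]
      split_ifs <;> omega
  | one => intro j hj; rw [ev_one hj]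
  | mul x y _ _ hx hy => intro j hj; rw [ev_mul, hx _ (ev_lt _ _), hy _ hj]
  | inv x _ hx => intro j hj; rw [← hx _ (ev_lt _ _), ev_ev_inv _ hj]

lemma valSet_mul_of_mem_WP (hk : kk ≤ m) (w : Equiv.Perm (Fin (2*m+2)))
    {p : Equiv.Perm (Fin (2*m+2))} (hp : p ∈ WP m kk) : valSet m kk (w * p) = valSet m kk w := by
  ext x
  rw [← fn_coe x, mem_valSet hk x.isLt, mem_valSet hk x.isLt]
  constructor
  · rintro ⟨j, hj, h⟩
    exact ⟨ev m p j, (ev_lt_iff_of_mem_WP hk hp j (by omega)).2 hj, by rw [← h, ev_mul]⟩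
  · rintro ⟨j, hj, h⟩
    exact ⟨ev m p⁻¹ j, (ev_lt_iff_of_mem_WP hk (inv_mem hp) j (by omega)).2 hj,
      by rw [ev_mul, ev_ev_inv _ (by omega), h]⟩

lemma valSet_eq_of_cosetEq (hk : kk ≤ m) {x y : Equiv.Perm (Fin (2*m+2))}
    (h : cosetEq m kk x y) : valSet m kk x = valSet m kk y := by
  rw [← valSet_mul_of_mem_WP hk x h, mul_inv_cancel_left]

lemma prod_mem_WP {l : List ℕ} (h : ∀ i ∈ l, (1 ≤ i ∧ i ≤ m+1) ∧ i ≠ kk) :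
    (l.map (sRefl m)).prod ∈ WP m kk := by
  apply Subgroup.list_prod_mem
  intro x hx
  obtain ⟨i, hi, rfl⟩ := List.mem_map.1 hx
  exact sRefl_mem_WP (h i hi).1.1 (h i hi).1.2 (h i hi).2

lemma cosetEq_of_valSet_eq (hk : kk ≤ m) {x y : Equiv.Perm (Fin (2*m+2))} (hx : x ∈ Weyl m)
    (hy : y ∈ Weyl m) (h : valSet m kk x = valSet m kk y) : cosetEq m kk x y := by
  obtain ⟨l, hl, hl', -⟩ := exists_sorted_mul_prod kk hx
  obtain ⟨r, hr, hr', -⟩ := exists_sorted_mul_prod kk hy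
  have hl := prod_mem_WP hl
  have hr := prod_mem_WP hr
  have key := hl'.eq_of_valSet_eq hk (mul_mem hx (WP_le_Weyl hl)) (mul_mem hy (WP_le_Weyl hr)) hr'
    (by rw [valSet_mul_of_mem_WP hk _ hl, valSet_mul_of_mem_WP hk _ hr, h])
  unfold cosetEq
  have : x⁻¹ * y = (l.map (sRefl m)).prod * ((r.map (sRefl m)).prod)⁻¹ := by
    rw [eq_mul_inv_iff_mul_eq, mul_assoc, ← key, inv_mul_cancel_left]
  rw [this]
  exact mul_mem hl (inv_mem hr)

end Cosets

/-! ### Evaluating the modified Hecke product -/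

section Hecke

variable {m kk : ℕ}

lemma hStepK_of_asc_or {w : Equiv.Perm (Fin (2*m+2))} {i : ℕ} (hw : w ∈ Weyl m) (h1 : 1 ≤ i)
    (h2 : i ≤ m+1) (h : i = kk ∨ Asc m w i) : hStepK m kk w i = w * sRefl m i := by
  rw [hStepK]
  exact if_pos (h.symm.imp_left (len_lt_len_mul_sRefl_iff hw h1 h2).2)

lemma hStepK_of_not_asc {w : Equiv.Perm (Fin (2*m+2))} {i : ℕ} (hw : w ∈ Weyl m) (h1 : 1 ≤ i)
    (h2 : i ≤ m+1) (hi : i ≠ kk) (h : ¬ Asc m w i) : hStepK m kk w i = w := by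
  rw [hStepK]
  exact if_neg (by rw [len_lt_len_mul_sRefl_iff hw h1 h2]; tauto)

lemma hWordK_append (w : Equiv.Perm (Fin (2*m+2))) (l r : List ℕ) :
    hWordK m kk w (l ++ r) = hWordK m kk (hWordK m kk w l) r :=
  List.foldl_append

lemma hWordK_cons (w : Equiv.Perm (Fin (2*m+2))) (i : ℕ) (l : List ℕ) :
    hWordK m kk w (i :: l) = hWordK m kk (hStepK m kk w i) l := rfl

lemma hWord_eq_hWordK {w : Equiv.Perm (Fin (2*m+2))} {l : List ℕ} (h : ∀ i ∈ l, 1 ≤ i) :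
    hWord m w l = hWordK m 0 w l := by
  induction l generalizing w with
  | nil => rfl
  | cons i l ih =>
    have hi := h i (by simp)
    have : hStep m w i = hStepK m 0 w i := by
      rw [hStep, hStepK]
      simp [show i ≠ 0 by omega]
    rw [hWordK_cons, ← this, ← ih fun j hj => h j (by simp [hj])]
    rfl

lemma hWordK_eq_self {w : Equiv.Perm (Fin (2*m+2))} {l : List ℕ} (hw : w ∈ Weyl m)
    (h : ∀ i ∈ l, (1 ≤ i ∧ i ≤ m+1) ∧ i ≠ kk ∧ ¬ Asc m w i) : hWordK m kk w l = w := by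
  induction l with
  | nil => rfl
  | cons i l ih =>
    have hi := h i (by simp)
    rw [hWordK_cons, hStepK_of_not_asc hw hi.1.1 hi.1.2 hi.2.1 hi.2.2]
    exact ih fun j hj => h j (by simp [hj])

lemma ev_mul_sRefl {w : Equiv.Perm (Fin (2*m+2))} {i j : ℕ} (h1 : 1 ≤ i) (h2 : i ≤ m)
    (hj : j ≤ m) : ev m (w * sRefl m i) j =
      if j = i-1 then ev m w i else if j = i then ev m w (i-1) else ev m w j := by
  rw [ev_mul, ev_sRefl h1 h2 (by omega)]
  split_ifs <;> first | rfl | omega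

/-- Multiplying by `s_{p+1} ⋯ s_{p+c}` moves the entry at position `p` to the right. -/
lemma ev_hWordK_range' {w : Equiv.Perm (Fin (2*m+2))} (hw : w ∈ Weyl m) {p c : ℕ}
    (hpc : p + c ≤ m) (h : ∀ j, p < j → j ≤ p + c → j = kk ∨ ev m w p < ev m w j) :
    hWordK m kk w (List.range' (p+1) c) ∈ Weyl m ∧
    ∀ j ≤ m, ev m (hWordK m kk w (List.range' (p+1) c)) j =
      if j < p then ev m w j else if j < p + c then ev m w (j+1)
        else if j = p + c then ev m w p else ev m w j := by
  induction c with
  | zero =>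
    refine ⟨hw, fun j hj => ?_⟩
    change ev m w j = _
    split_ifs <;> first | rfl | omega | (congr 1)
  | succ c ih =>
    obtain ⟨ih1, ih2⟩ := ih (by omega) (fun j h1 h2 => h j h1 (by omega))
    rw [List.range'_1_concat, hWordK_append, hWordK_cons]
    set w' := hWordK m kk w (List.range' (p+1) c)
    have e1 : ev m w' (p+1+c-1) = ev m w p := by
      rw [ih2 _ (by omega), if_neg (by omega), if_neg (by omega), if_pos (by omega)]
    have e2 : ev m w' (p+1+c) = ev m w (p+1+c) := by
      rw [ih2 _ (by omega), if_neg (by omega), if_neg (by omega), if_neg (by omega)]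
    rw [hStepK_of_asc_or ih1 (by omega) (by omega)]
    · refine ⟨mul_mem ih1 (sRefl_mem_Weyl (by omega) (by omega)), fun j hj => ?_⟩
      change ev m (w' * _) j = _
      rw [ev_mul_sRefl (by omega) (by omega) hj, e1, e2]
      by_cases c1 : j = p + 1 + c - 1
      · rw [if_pos c1, if_neg (by omega), if_pos (by omega)]
        congr 1
        omega
      · by_cases c2 : j = p + 1 + c
        · rw [if_neg c1, if_pos c2, if_neg (by omega), if_neg (by omega), if_pos (by omega)]
        · rw [if_neg c1, if_neg c2, ih2 _ hj]
          split_ifs <;> first | rfl | omega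
    · rcases h (p+1+c) (by omega) (by omega) with h' | h'
      · exact Or.inl h'
      · right
        unfold Asc
        rwa [e1, e2]

/-- Multiplying by `s_{p+c} ⋯ s_{p+1}` moves the entry at position `p + c` to the left. -/
lemma ev_hWordK_range'_reverse {w : Equiv.Perm (Fin (2*m+2))} (hw : w ∈ Weyl m) {p c : ℕ}
    (hpc : p + c ≤ m) (h : ∀ j, p ≤ j → j < p + c → j + 1 = kk ∨ ev m w j < ev m w (p+c)) :
    hWordK m kk w (List.range' (p+1) c).reverse ∈ Weyl m ∧
    ∀ j ≤ m, ev m (hWordK m kk w (List.range' (p+1) c).reverse) j =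
      if j < p then ev m w j else if j = p then ev m w (p+c)
        else if j ≤ p + c then ev m w (j-1) else ev m w j := by
  induction c generalizing w with
  | zero =>
    refine ⟨hw, fun j hj => ?_⟩
    change ev m w j = _
    split_ifs <;> first | rfl | omega | (congr 1)
  | succ c ih =>
    rw [List.range'_1_concat, List.reverse_append, List.reverse_singleton, List.singleton_append,
      hWordK_cons]
    have hstep : hStepK m kk w (p+1+c) = w * sRefl m (p+1+c) := by
      apply hStepK_of_asc_or hw (by omega) (by omega)
      rcases h (p+c) (by omega) (by omega) with h' | h'
      · left; omega
      · right
        unfold Asc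
        rwa [show p+1+c-1 = p+c by omega, show p+1+c = p+(c+1) by omega]
    rw [hstep]
    have e1 : ev m (w * sRefl m (p+1+c)) (p+c) = ev m w (p+(c+1)) := by
      rw [ev_mul_sRefl (by omega) (by omega) (by omega), if_pos (by omega)]
      congr 1
      omega
    have e2 : ∀ j < p + c, ev m (w * sRefl m (p+1+c)) j = ev m w j := by
      intro j hj
      rw [ev_mul_sRefl (by omega) (by omega) (by omega), if_neg (by omega), if_neg (by omega)]
    obtain ⟨ih1, ih2⟩ := ih (mul_mem hw (sRefl_mem_Weyl (i := p+1+c) (by omega) (by omega)))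
      (by omega) (fun j h1 h2 => by
        rw [e1, e2 j h2]
        exact h j h1 (by omega))
    refine ⟨ih1, fun j hj => ?_⟩
    rw [ih2 j hj, e1]
    by_cases c1 : j < p
    · rw [if_pos c1, if_pos c1, e2 j (by omega)]
    · by_cases c2 : j = p
      · rw [if_neg c1, if_neg c1, if_pos c2, if_pos c2]
      · by_cases c3 : j ≤ p + c
        · rw [if_neg c1, if_neg c1, if_neg c2, if_neg c2, if_pos c3, if_pos (by omega),
            e2 _ (by omega)]
        · rw [if_neg c1, if_neg c1, if_neg c2, if_neg c2, if_neg c3,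
            ev_mul_sRefl (by omega) (by omega) (by omega)]
          by_cases c4 : j = p + 1 + c
          · rw [if_neg (by omega), if_pos c4, if_pos (by omega), c4]
          · rw [if_neg (by omega), if_neg c4, if_neg (by omega)]

lemma ev_hWordK_last {w : Equiv.Perm (Fin (2*m+2))} (hw : w ∈ Weyl m) (h : ev m w m ≤ m) :
    hWordK m kk w [m+1] ∈ Weyl m ∧
    ∀ j ≤ m, ev m (hWordK m kk w [m+1]) j = if j = m then 2*m+1 - ev m w m else ev m w j := by
  have hb := ev_bar hw (i := m) (j := m+1) (by omega)
  have e : hWordK m kk w [m+1] = w * sRefl m (m+1) := by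
    rw [hWordK_cons, hStepK_of_asc_or hw (by omega) le_rfl]
    · rfl
    · right
      unfold Asc
      rw [Nat.add_sub_cancel]
      omega
  rw [e]
  refine ⟨mul_mem hw (sRefl_mem_Weyl (by omega) le_rfl), fun j hj => ?_⟩
  rw [ev_mul, ev_sRefl_last (by omega)]
  split_ifs <;> omega

/-- `w` has one-line notation `bar 2, …, bar e, bar (k+1), e+1, …, k, 1, k+2, …, m+1`. -/
def IsOYState (m kk e : ℕ) (w : Equiv.Perm (Fin (2*m+2))) : Prop :=
  w ∈ Weyl m ∧ ∀ j ≤ m, ev m w j =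
    if j + 1 < e then 2*m - j else if j + 1 = e then 2*m+1-kk else if j = kk then 0 else j

lemma isOYState_mulOY1 (hk : 1 ≤ kk) (hkm : kk ≤ m) : IsOYState m kk 1 (mulOY1 m kk 1) := by
  have hword : wordOY1 m kk = List.range' (0+1) (kk-1) ++ (List.range' (kk+1) (m-kk) ++
      ([m+1] ++ (List.range' (0+1) m).reverse)) := by
    unfold wordOY1 ascList
    rw [show kk - 1 + 1 - 1 = kk - 1 by omega, show m+1+1-(kk+1) = (m-kk)+1 by omega,
      List.range'_1_concat, show kk + 1 + (m-kk) = m+1 by omega]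
    simp
  unfold mulOY1
  rw [hWord_eq_hWordK, hword, hWordK_append, hWordK_append, hWordK_append]
  · obtain ⟨a1, a2⟩ := ev_hWordK_range' (m := m) (kk := 0) (one_mem (Weyl m)) (p := 0) (c := kk-1)
      (by omega) (fun j h1 h2 => by
        rw [ev_one (by omega), ev_one (by omega)]
        omega)
    set w1 := hWordK m 0 1 (List.range' (0+1) (kk-1))
    have a3 : ∀ j ≤ m, ev m w1 j = if j + 1 < kk then j + 1 else if j + 1 = kk then 0 else j := by
      intro j hj
      rw [a2 j hj, ev_one (by omega), ev_one (by omega), ev_one (by omega)]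
      split_ifs <;> omega
    obtain ⟨b1, b2⟩ := ev_hWordK_range' (kk := 0) a1 (p := kk) (c := m-kk)
      (by omega) (fun j h1 h2 => by
        rw [a3 _ (by omega), a3 _ (by omega)]
        split_ifs <;> omega)
    set w2 := hWordK m 0 w1 (List.range' (kk+1) (m-kk))
    have b3 : ∀ j ≤ m, ev m w2 j = if j + 1 < kk then j + 1 else if j + 1 = kk then 0 else
        if j < m then j + 1 else kk := by
      intro j hj
      rw [b2 j hj]
      split_ifs <;> first | omega | (rw [a3 _ (by omega)]; split_ifs <;> omega)
    obtain ⟨c1, c2⟩ := ev_hWordK_last (kk := 0) b1 (by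
      rw [b3 _ le_rfl]
      split_ifs <;> omega)
    set w3 := hWordK m 0 w2 [m+1]
    have c3 : ∀ j ≤ m, ev m w3 j = if j = m then 2*m+1-kk else
        if j + 1 = kk then 0 else j + 1 := by
      intro j hj
      rw [c2 j hj, b3 _ le_rfl, b3 _ hj]
      split_ifs <;> omega
    obtain ⟨d1, d2⟩ := ev_hWordK_range'_reverse (kk := 0) c1 (p := 0) (c := m)
      (by omega) (fun j h1 h2 => by
        rw [c3 _ (by omega), c3 _ (by omega)]
        split_ifs <;> omega)
    refine ⟨d1, fun j hj => ?_⟩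
    rw [d2 j hj, c3 _ (by omega), c3 _ (by omega), c3 _ (by omega)]
    split_ifs <;> omega
  · intro i hi
    rw [hword] at hi
    simp only [List.mem_append, List.mem_reverse, List.mem_range'_1, List.mem_singleton] at hi
    omega

lemma isOYState_succ {e : ℕ} {w : Equiv.Perm (Fin (2*m+2))} (hkm : kk ≤ m) (he : 1 ≤ e)
    (hek : e < kk) (h : IsOYState m kk e w) :
    IsOYState m kk (e+1) (hWordK m kk w (wordOcirc1 m)) := by
  obtain ⟨hw, hv⟩ := h
  have hword : wordOcirc1 m = List.range' 1 e ++ (List.range' (e+1) (m-e) ++ ([m+1] ++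
      ((List.range' (e-1+1) (m-e+1)).reverse ++ (List.range' 1 (e-1)).reverse))) := by
    unfold wordOcirc1 ascList
    have h1 : List.range' 1 (m+1+1-1) = List.range' 1 e ++ (List.range' (e+1) (m-e) ++ [m+1]) := by
      have : m + 1 + 1 - 1 = e + ((m - e) + 1) := by omega
      rw [this, ← List.range'_append_1, List.range'_1_concat, show 1 + e = e + 1 by omega,
        show e + 1 + (m - e) = m + 1 by omega]
    have h2 : List.range' 1 (m+1-1) = List.range' 1 (e-1) ++ List.range' (e-1+1) (m-e+1) := by
      have : m + 1 - 1 = (e - 1) + (m - e + 1) := by omega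
      rw [this, ← List.range'_append_1, show 1 + (e - 1) = e - 1 + 1 by omega]
    rw [h1, h2, List.reverse_append]
    simp only [List.append_assoc]
  rw [hword, hWordK_append, hWordK_append, hWordK_append, hWordK_append]
  rw [hWordK_eq_self (l := List.range' 1 e) hw]
  · obtain ⟨b1, b2⟩ := ev_hWordK_range' (kk := kk) hw (p := e) (c := m-e)
      (by omega) (fun j h1 h2 => by
        rw [hv _ (by omega), hv _ (by omega)]
        split_ifs <;> omega)
    set w2 := hWordK m kk w (List.range' (e+1) (m-e))
    have b3 : ∀ j ≤ m, ev m w2 j = if j + 1 < e then 2*m - j else if j + 1 = e then 2*m+1-kk else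
        if j = m then e else if j + 1 = kk then 0 else j + 1 := by
      intro j hj
      rw [b2 j hj]
      split_ifs <;> first | omega | (rw [hv _ (by omega)]; split_ifs <;> omega)
    obtain ⟨c1, c2⟩ := ev_hWordK_last (kk := kk) b1 (by
      rw [b3 _ le_rfl]
      split_ifs <;> omega)
    set w3 := hWordK m kk w2 [m+1]
    have c3 : ∀ j ≤ m, ev m w3 j = if j + 1 < e then 2*m - j else
        if j + 1 = e then 2*m+1-kk else
        if j = m then 2*m+1-e else if j + 1 = kk then 0 else j + 1 := by
      intro j hj
      rw [c2 j hj, b3 _ le_rfl, b3 _ hj]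
      split_ifs <;> omega
    obtain ⟨d1, d2⟩ := ev_hWordK_range'_reverse (kk := kk) c1 (p := e-1) (c := m-e+1)
      (by omega) (fun j h1 h2 => by
        rw [c3 _ (by omega), c3 _ (by omega)]
        split_ifs <;> omega)
    set w4 := hWordK m kk w3 (List.range' (e-1+1) (m-e+1)).reverse
    have d3 : ∀ j ≤ m, ev m w4 j = if j + 1 < e + 1 then 2*m - j else
        if j + 1 = e + 1 then 2*m+1-kk else if j = kk then 0 else j := by
      intro j hj
      rw [d2 j hj, c3 _ (by omega), c3 _ (by omega), c3 _ (by omega)]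
      split_ifs <;> omega
    rw [hWordK_eq_self d1]
    · exact ⟨d1, d3⟩
    · intro i hi
      rw [List.mem_reverse, List.mem_range'_1] at hi
      refine ⟨by omega, by omega, ?_⟩
      unfold Asc
      rw [d3 _ (by omega), d3 _ (by omega)]
      split_ifs <;> omega
  · intro i hi
    rw [List.mem_range'_1] at hi
    refine ⟨by omega, by omega, ?_⟩
    unfold Asc
    rw [hv _ (by omega), hv _ (by omega)]
    split_ifs <;> omega

lemma isOYState_mulOY (hk : 1 ≤ kk) (hkm : kk ≤ m) {d : ℕ} (hd : 1 ≤ d) (hdk : d ≤ kk) :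
    IsOYState m kk d (mulOY m kk 1 d) := by
  have key : ∀ e, e < kk → IsOYState m kk (e+1) (mulOcirc m kk (mulOY1 m kk 1) e) := by
    intro e
    induction e with
    | zero => intro _; exact isOYState_mulOY1 hk hkm
    | succ e ih =>
      intro he
      have := isOYState_succ hkm (by omega) he (ih (by omega))
      unfold mulOcirc wordOcirc at this ⊢
      rwa [List.replicate_succ', List.flatten_append, List.flatten_singleton, hWordK_append]
  have := key (d-1) (by omega)
  rwa [Nat.sub_add_cancel hd] at this

/-- Membership of a value in `{d+1, …, k, bar (k+1), bar d, …, bar 2}` (0-indexed). -/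
def InTop (m kk d x : ℕ) : Prop :=
  (d ≤ x ∧ x < kk) ∨ x = 2*m+1-kk ∨ (2*m+2 ≤ x + d ∧ x ≤ 2*m)

lemma IsOYState.mem_valSet_iff {d x : ℕ} {w : Equiv.Perm (Fin (2*m+2))} (h : IsOYState m kk d w)
    (hkm : kk ≤ m) (hd : 1 ≤ d) (hdk : d ≤ kk) (hx : x < 2*m+2) :
    fn m x ∈ valSet m kk w ↔ InTop m kk d x := by
  rw [mem_valSet hkm hx]
  unfold InTop
  constructor
  · rintro ⟨j, hj, rfl⟩
    rw [h.2 j (by omega)]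
    split_ifs <;> omega
  · rintro (hx | hx | hx)
    · refine ⟨x, by omega, ?_⟩
      rw [h.2 _ (by omega)]
      split_ifs <;> omega
    · refine ⟨d-1, by omega, ?_⟩
      rw [h.2 _ (by omega)]
      split_ifs <;> omega
    · refine ⟨2*m-x, by omega, ?_⟩
      rw [h.2 _ (by omega)]
      split_ifs <;> omega

end Hecke

/-! ### Reflections and chains -/

section Reflections

variable {m kk : ℕ}

lemma ev_refl_tm {i j x : ℕ} (h : (PosRoot.tm i j).valid m) (hx : x < 2*m+2) :
    ev m ((PosRoot.tm i j).refl m) x = if x = i-1 then j-1 else if x = j-1 then i-1 else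
      if x = 2*m+2-i then 2*m+2-j else if x = 2*m+2-j then 2*m+2-i else x := by
  obtain ⟨h1, h2, h3⟩ := h
  rw [PosRoot.refl, ev_mul, ev_swap (by omega) (by omega) (ev_lt _ _),
    ev_swap (by omega) (by omega) hx]
  split_ifs <;> omega

lemma ev_refl_tp {i j x : ℕ} (h : (PosRoot.tp i j).valid m) (hx : x < 2*m+2) :
    ev m ((PosRoot.tp i j).refl m) x = if x = i-1 then 2*m+2-j else if x = 2*m+2-j then i-1 else
      if x = j-1 then 2*m+2-i else if x = 2*m+2-i then j-1 else x := by
  obtain ⟨h1, h2, h3⟩ := h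
  rw [PosRoot.refl, ev_mul, ev_swap (by omega) (by omega) (ev_lt _ _),
    ev_swap (by omega) (by omega) hx]
  split_ifs <;> omega

lemma ev_refl_lg {i x : ℕ} (h : (PosRoot.lg i).valid m) (hx : x < 2*m+2) :
    ev m ((PosRoot.lg i).refl m) x = if x = i-1 then 2*m+2-i else if x = 2*m+2-i then i-1 else
      x := by
  obtain ⟨h1, h2⟩ := h
  rw [PosRoot.refl, ev_swap (by omega) (by omega) hx]

lemma refl_mem_Weyl {a : PosRoot} (h : a.valid m) : a.refl m ∈ Weyl m := by
  rw [mem_Weyl]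
  intro x hx
  cases a with
  | tm i j =>
    rw [ev_refl_tm h (by omega), ev_refl_tm h hx]
    obtain ⟨h1, h2, h3⟩ := h
    split_ifs <;> omega
  | tp i j =>
    rw [ev_refl_tp h (by omega), ev_refl_tp h hx]
    obtain ⟨h1, h2, h3⟩ := h
    split_ifs <;> omega
  | lg i =>
    rw [ev_refl_lg h (by omega), ev_refl_lg h hx]
    obtain ⟨h1, h2⟩ := h
    split_ifs <;> omega

/-- A root reflection moves at most `corootCoeff` of the first `kk` positions out. -/
lemma card_filter_refl_le {a : PosRoot} (h : a.valid m) (hk : kk ≤ m) :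
    ((Finset.range kk).filter fun x => kk ≤ ev m (a.refl m) x).card ≤ a.corootCoeff kk := by
  have key : ∀ s : Finset ℕ, s.card ≤ a.corootCoeff kk →
      (∀ x < kk, kk ≤ ev m (a.refl m) x → x ∈ s) →
      ((Finset.range kk).filter fun x => kk ≤ ev m (a.refl m) x).card ≤ a.corootCoeff kk := by
    intro s hs hsub
    refine (Finset.card_le_card fun x hx => ?_).trans hs
    rw [Finset.mem_filter, Finset.mem_range] at hx
    exact hsub x hx.1 hx.2
  cases a with
  | tm i j =>
    have hv := h
    obtain ⟨h1, h2, h3⟩ := h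
    by_cases c : i ≤ kk ∧ kk < j
    · apply key {i-1}
      · simp [PosRoot.corootCoeff, c]
      · intro x hx hx'
        rw [ev_refl_tm hv (by omega)] at hx'
        rw [Finset.mem_singleton]
        split_ifs at hx' <;> omega
    · apply key ∅
      · simp
      · intro x hx hx'
        rw [ev_refl_tm hv (by omega)] at hx'
        split_ifs at hx' <;> omega
  | tp i j =>
    have hv := h
    obtain ⟨h1, h2, h3⟩ := h
    by_cases c : i ≤ kk ∧ kk < j
    · apply key {i-1}
      · simp [PosRoot.corootCoeff, c]
      · intro x hx hx'
        rw [ev_refl_tp hv (by omega)] at hx'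
        rw [Finset.mem_singleton]
        split_ifs at hx' <;> omega
    · by_cases c' : j ≤ kk
      · apply key {i-1, j-1}
        · simp only [PosRoot.corootCoeff, if_neg c, if_pos c']
          exact Finset.card_le_two
        · intro x hx hx'
          rw [ev_refl_tp hv (by omega)] at hx'
          rw [Finset.mem_insert, Finset.mem_singleton]
          split_ifs at hx' <;> omega
      · apply key ∅
        · simp
        · intro x hx hx'
          rw [ev_refl_tp hv (by omega)] at hx'
          split_ifs at hx' <;> omega
  | lg i =>
    have hv := h
    obtain ⟨h1, h2⟩ := h
    by_cases c : i ≤ kk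
    · apply key {i-1}
      · simp [PosRoot.corootCoeff, c]
      · intro x hx hx'
        rw [ev_refl_lg hv (by omega)] at hx'
        rw [Finset.mem_singleton]
        split_ifs at hx' <;> omega
    · apply key ∅
      · simp
      · intro x hx hx'
        rw [ev_refl_lg hv (by omega)] at hx'
        split_ifs at hx' <;> omega

lemma card_valSet_sdiff_le {a : PosRoot} (h : a.valid m) (hk : kk ≤ m)
    {u v : Equiv.Perm (Fin (2*m+2))} (huv : cosetEq m kk v (u * a.refl m)) :
    (valSet m kk v \ valSet m kk u).card ≤ a.corootCoeff kk := by
  rw [valSet_eq_of_cosetEq hk huv]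
  refine (Finset.card_le_card (t := (((Finset.range kk).filter fun x =>
    kk ≤ ev m (a.refl m) x).image fun x => fn m (ev m u (ev m (a.refl m) x)))) ?_).trans
    (Finset.card_image_le.trans (card_filter_refl_le h hk))
  intro x hx
  rw [← fn_coe x, Finset.mem_sdiff, mem_valSet hk x.isLt, mem_valSet hk x.isLt] at hx
  obtain ⟨⟨j, hj, hjx⟩, hx2⟩ := hx
  rw [ev_mul] at hjx
  refine Finset.mem_image.2 ⟨j, ?_, by rw [hjx, fn_coe]⟩
  rw [Finset.mem_filter, Finset.mem_range]
  refine ⟨hj, ?_⟩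
  by_contra hlt
  exact hx2 ⟨_, by omega, hjx⟩

lemma ChainO.card_valSet_sdiff_le (hk : kk ≤ m) {u w : Equiv.Perm (Fin (2*m+2))} {d : ℕ}
    (h : ChainO m kk u w d) : (valSet m kk w \ valSet m kk u).card ≤ d := by
  induction h with
  | nil u => simp
  | cons a v h1 _ _ _ h5 _ ih =>
    refine (Finset.card_le_card (sdiff_triangle _ (valSet m kk v) _)).trans ?_
    refine (Finset.card_union_le _ _).trans ?_
    have := OddSymplectic.card_valSet_sdiff_le h1 hk h5
    omega

lemma ChainO.snoc {u w v : Equiv.Perm (Fin (2*m+2))} {d : ℕ} (h : ChainO m kk u w d)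
    (a : PosRoot) (h1 : a.valid m) (h2 : a.rootCoeff m kk ≠ 0) (h3 : isMinRep m kk v)
    (h4 : isOdd m v) (h5 : cosetEq m kk v (w * a.refl m)) :
    ChainO m kk u v (d + a.corootCoeff kk) := by
  induction h with
  | nil u =>
    rw [Nat.add_comm]
    exact ChainO.cons a v h1 h2 h3 h4 h5 (ChainO.nil v)
  | cons b x g1 g2 g3 g4 g5 _ ih =>
    rw [Nat.add_assoc]
    exact ChainO.cons b x g1 g2 g3 g4 g5 (ih h5)

lemma Sorted.isOdd {w : Equiv.Perm (Fin (2*m+2))} (h : Sorted m kk w) (hw : w ∈ Weyl m)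
    (hk : kk ≤ m) (h0 : fn m (2*m+1) ∉ valSet m kk w) : isOdd m w := by
  intro j hj hc
  have h1 : ev m w j = 2*m+1 := by rw [← coe_apply, hc, fn_val (by omega)]
  rcases Nat.lt_or_ge (j : ℕ) kk with hjk | hjk
  · exact h0 ((mem_valSet hk (by omega)).2 ⟨j, hjk, h1⟩)
  · have := h.high_le hw hjk hj
    omega

lemma valSet_eq_iff (w w' : Equiv.Perm (Fin (2*m+2))) : valSet m kk w = valSet m kk w' ↔
    ∀ x < 2*m+2, (fn m x ∈ valSet m kk w ↔ fn m x ∈ valSet m kk w') := by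
  constructor
  · intro h x _
    rw [h]
  · intro h
    ext x
    rw [← fn_coe x]
    exact h x x.isLt

lemma chainO_of_valSet (hkm : kk ≤ m) {d : ℕ} (hd : 1 ≤ d) (hdk : d ≤ kk)
    {v : Equiv.Perm (Fin (2*m+2))} (hv : isMinRep m kk v)
    (h : ∀ x < 2*m+2, (fn m x ∈ valSet m kk v ↔ InTop m kk d x)) : ChainO m kk 1 v d := by
  induction d, hd using Nat.le_induction generalizing v with
  | base =>
    have hval : (PosRoot.tp 1 (kk+1)).valid m := ⟨by omega, by omega, by omega⟩
    have hodd : isOdd m v := hv.sorted.isOdd hv.1 hkm (by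
      rw [h _ (by omega)]
      unfold InTop
      omega)
    have key := ChainO.cons (u := 1) (.tp 1 (kk+1)) v hval (by simp [PosRoot.rootCoeff, hdk]) hv
      hodd (cosetEq_of_valSet_eq hkm hv.1 (mul_mem (one_mem _) (refl_mem_Weyl hval)) (by
        rw [valSet_eq_iff]
        intro x hx
        rw [h x hx, mem_valSet hkm hx, one_mul]
        unfold InTop
        constructor
        · intro hx'
          by_cases c : x = 2*m+1-kk
          · refine ⟨0, by omega, ?_⟩
            rw [ev_refl_tp hval (by omega)]
            split_ifs <;> omega
          · refine ⟨x, by omega, ?_⟩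
            rw [ev_refl_tp hval (by omega)]
            split_ifs <;> omega
        · rintro ⟨j, hj, rfl⟩
          rw [ev_refl_tp hval (by omega)]
          split_ifs <;> omega)) (ChainO.nil v)
    simpa [PosRoot.corootCoeff, hdk] using key
  | succ e he ih =>
    have hst := isOYState_mulOY (m := m) (kk := kk) (by omega) hkm he (by omega)
    obtain ⟨w, hw, hwc⟩ := exists_isMinRep (kk := kk) hst.1
    have hws : ∀ x < 2*m+2, (fn m x ∈ valSet m kk w ↔ InTop m kk e x) := fun x hx => by
      rw [valSet_eq_of_cosetEq hkm hwc, hst.mem_valSet_iff hkm he (by omega) hx]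
    obtain ⟨j, hj, hje⟩ := (mem_valSet hkm (by omega)).1 ((hws e (by omega)).2 (by
      unfold InTop; omega))
    have hval : (PosRoot.lg (j+1)).valid m := ⟨by omega, by omega⟩
    have hodd : isOdd m v := hv.sorted.isOdd hv.1 hkm (by
      rw [h _ (by omega)]
      unfold InTop
      omega)
    have hjb := ev_bar hw.1 (i := j) (j := 2*m+1-j) (by omega)
    have key := (ih (by omega) hw hws).snoc (.lg (j+1)) hval
      (by simp only [PosRoot.rootCoeff]; split_ifs <;> omega) hv
      hodd (cosetEq_of_valSet_eq hkm hv.1 (mul_mem hw.1 (refl_mem_Weyl hval)) (by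
        rw [valSet_eq_iff]
        intro x hx
        rw [h x hx, mem_valSet hkm hx]
        constructor
        · intro hx'
          by_cases c : x = 2*m+1-e
          · refine ⟨j, hj, ?_⟩
            rw [ev_mul, ev_refl_lg hval (by omega), if_pos (by omega),
              show 2*m+2-(j+1) = 2*m+1-j by omega]
            omega
          · obtain ⟨i, hi, hix⟩ := (mem_valSet hkm hx).1 ((hws x hx).2 (by
              unfold InTop at hx' ⊢; omega))
            refine ⟨i, hi, ?_⟩
            rw [ev_mul, ev_refl_lg hval (by omega), if_neg, if_neg (by omega), hix]
            intro hij
            obtain rfl : i = j := by omega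
            unfold InTop at hx'
            omega
        · rintro ⟨i, hi, rfl⟩
          rw [ev_mul, ev_refl_lg hval (by omega)]
          by_cases c : i = j
          · rw [if_pos (by omega), show 2*m+2-(j+1) = 2*m+1-j by omega]
            unfold InTop
            omega
          · rw [if_neg (by omega), if_neg (by omega)]
            have h1 := (hws _ (ev_lt w i)).1 ((mem_valSet hkm (ev_lt w i)).2 ⟨i, hi, rfl⟩)
            have h2 := (ev_inj w (i := i) (j := j) (by omega) (by omega)).not.2 c
            unfold InTop at h1 ⊢
            omega))
    simpa [PosRoot.corootCoeff, show j + 1 ≤ kk by omega] using key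

end Reflections

/-! ### Bruhat order -/

section Bruhat

variable {m : ℕ}

lemma bruhatLE_mul_left {u t : Equiv.Perm (Fin (2*m+2))} (hu : u ∈ Weyl m)
    (ht : t ∈ reflections m) (h : len m u⁻¹ < len m (u⁻¹ * t)) (htt : t⁻¹ = t) :
    bruhatLE m u (t * u) ∧ len m u < len m (t * u) := by
  have h1 : len m u < len m (t * u) := by
    rwa [len_inv, ← len_inv (u⁻¹ * t), mul_inv_rev, inv_inv, htt] at h
  refine ⟨Relation.ReflTransGen.single ⟨u⁻¹ * t * u, ?_, by group, h1⟩, h1⟩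
  obtain ⟨v, hv, i, hi1, hi2, rfl⟩ := ht
  exact ⟨u⁻¹ * v, mul_mem (inv_mem hu) hv, i, hi1, hi2, by group⟩

lemma sRefl_mem_reflections {i : ℕ} (h1 : 1 ≤ i) (h2 : i ≤ m+1) : sRefl m i ∈ reflections m :=
  ⟨1, one_mem _, i, h1, h2, by simp⟩

lemma refl_tm_succ_self {p : ℕ} (h : p ≤ m) :
    (PosRoot.tm p (p+1)).refl m = sRefl m p := by
  rw [PosRoot.refl, sRefl, if_pos h, Nat.add_sub_cancel, show 2*m+2-(p+1) = 2*m+1-p by omega]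

lemma refl_tm_succ {p q : ℕ} (h1 : 1 ≤ p) (h2 : p < q) (h3 : q ≤ m) :
    (PosRoot.tm p (q+1)).refl m = sRefl m q * (PosRoot.tm p q).refl m * sRefl m q := by
  have key : ∀ x y, ev m (sRefl m q) x = y → sRefl m q (fn m x) = fn m y :=
    fun x y h => by rw [← fn_ev, h]
  have e : ∀ a b c e : Fin (2*m+2), sRefl m q * (swap a b * swap c e) * sRefl m q =
      swap (sRefl m q a) (sRefl m q b) * swap (sRefl m q c) (sRefl m q e) := fun a b c e => by
    rw [swap_apply_apply, swap_apply_apply, sRefl_inv (by omega) (by omega)]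
    simp only [mul_assoc]
    rw [← mul_assoc (sRefl m q) (sRefl m q), sRefl_mul_self (by omega) (by omega), one_mul]
  rw [PosRoot.refl, PosRoot.refl, e, key (p-1) (p-1), key (q-1) q,
    key (2*m+2-p) (2*m+2-p), key (2*m+2-q) (2*m+1-q), Nat.add_sub_cancel,
    show 2*m+2-(q+1) = 2*m+1-q by omega]
  all_goals
    rw [ev_sRefl (by omega) h3 (by omega)]
    split_ifs <;> omega

lemma refl_tm_mem_reflections {p q : ℕ} (h1 : 1 ≤ p) (h2 : p < q) (h3 : q ≤ m+1) :
    (PosRoot.tm p q).refl m ∈ reflections m := by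
  induction q, h2 using Nat.le_induction with
  | base =>
    rw [Nat.succ_eq_add_one, refl_tm_succ_self (by omega)]
    exact sRefl_mem_reflections h1 (by omega)
  | succ q hq ih =>
    obtain ⟨v, hv, i, hi1, hi2, h⟩ := ih (by omega)
    refine ⟨sRefl m q * v, mul_mem (sRefl_mem_Weyl (by omega) (by omega)) hv, i, hi1, hi2, ?_⟩
    rw [refl_tm_succ h1 hq (by omega), h, mul_inv_rev, sRefl_inv (by omega) (by omega)]
    simp only [mul_assoc]

lemma len_lt_len_mul_refl_tm {p q : ℕ} (h1 : 1 ≤ p) (h2 : p < q) (h3 : q ≤ m+1)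
    {w : Equiv.Perm (Fin (2*m+2))} (hw : w ∈ Weyl m) (h : ev m w (p-1) < ev m w (q-1)) :
    len m w < len m (w * (PosRoot.tm p q).refl m) := by
  induction q, h2 using Nat.le_induction generalizing w with
  | base =>
    rw [Nat.succ_eq_add_one, refl_tm_succ_self (by omega),
      len_lt_len_mul_sRefl_iff hw h1 (by omega)]
    exact h
  | succ q hq ih =>
    rw [Nat.succ_eq_add_one] at hq
    have v2 : (PosRoot.tm p q).valid m := ⟨by omega, by omega, by omega⟩
    have hs : sRefl m q ∈ Weyl m := sRefl_mem_Weyl (by omega) (by omega)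
    have hws := mul_mem hw hs
    have e1 : ev m (w * sRefl m q) (p-1) = ev m w (p-1) := by
      rw [ev_mul, ev_sRefl (by omega) (by omega) (by omega)]
      congr 1
      split_ifs <;> omega
    have e2 : ev m (w * sRefl m q) (q-1) = ev m w q := ev_mul_sRefl_left w (by omega) (by omega)
    have e3 : ev m (w * sRefl m q) q = ev m w (q-1) := ev_mul_sRefl_right w (by omega) (by omega)
    rw [Nat.add_sub_cancel] at h
    have key := ih (by omega) hws (by rw [e1, e2]; exact h)
    have hx := mul_mem hws (refl_mem_Weyl v2)
    rw [refl_tm_succ h1 hq (by omega), ← mul_assoc, ← mul_assoc]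
    set x := w * sRefl m q * (PosRoot.tm p q).refl m with hxdef
    have e4 : ev m x (q-1) = ev m w (p-1) := by
      rw [hxdef, ev_mul, ev_refl_tm v2 (by omega), if_neg (by omega), if_pos rfl, e1]
    have e5 : ev m x q = ev m w (q-1) := by
      rw [hxdef, ev_mul, ev_refl_tm v2 (by omega), ← e3]
      congr 1
      split_ifs <;> omega
    by_cases ha : Asc m w q
    · have g1 := len_mul_sRefl_of_asc hw (by omega) (by omega) ha
      by_cases hb : Asc m x q
      · have g2 := len_mul_sRefl_of_asc hx (by omega) (by omega) hb
        omega
      · have g2 := len_of_not_asc hx (by omega) (by omega) hb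
        omega
    · have g1 := len_of_not_asc hw (by omega) (by omega) ha
      have hb : Asc m x q := by
        unfold Asc at ha ⊢
        omega
      have g2 := len_mul_sRefl_of_asc hx (by omega) (by omega) hb
      omega

lemma refl_tm_inv {p q : ℕ} (h : (PosRoot.tm p q).valid m) :
    ((PosRoot.tm p q).refl m)⁻¹ = (PosRoot.tm p q).refl m := by
  apply inv_eq_of_mul_eq_one_left
  apply ext_ev
  intro x hx
  rw [ev_mul, ev_refl_tm h (ev_lt _ _), ev_refl_tm h hx, ev_one hx]
  obtain ⟨h1, h2, h3⟩ := h
  split_ifs <;> omega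

end Bruhat

/-! ### Bruhat-maximality -/

section Maximal

variable {m kk d : ℕ}

/-- Minimal representatives `u` for which neither `0` nor `2m+1` occurs among the first `kk`
values and at least `kk - d` of these values are smaller than `kk`. -/
structure IsCandidate (m kk d : ℕ) (u : Equiv.Perm (Fin (2*m+2))) : Prop where
  mem_Weyl : u ∈ Weyl m
  sorted : Sorted m kk u
  zero : kk ≤ ev m u⁻¹ 0
  last : kk ≤ ev m u⁻¹ (2*m+1)
  card : kk ≤ d + ((Finset.range kk).filter (fun x => ev m u⁻¹ x < kk)).card

lemma ev_inv_lt_iff {u : Equiv.Perm (Fin (2*m+2))} {x : ℕ} (hkm : kk ≤ m) (hx : x < 2*m+2) :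
    ev m u⁻¹ x < kk ↔ fn m x ∈ valSet m kk u := by
  rw [mem_valSet hkm hx]
  constructor
  · intro h
    exact ⟨_, h, ev_ev_inv u hx⟩
  · rintro ⟨j, hj, rfl⟩
    rwa [ev_inv_ev u (by omega)]

lemma card_filter_ev_inv_lt {u : Equiv.Perm (Fin (2*m+2))} (hkm : kk ≤ m) :
    ((Finset.range (2*m+2)).filter (fun x => ev m u⁻¹ x < kk)).card = kk := by
  conv_rhs => rw [← Finset.card_range kk]
  refine Finset.card_nbij' (ev m u⁻¹) (ev m u) ?_ ?_ ?_ ?_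
  · intro x hx
    simpa using (Finset.mem_filter.1 hx).2
  · intro x hx
    rw [Finset.mem_coe, Finset.mem_range] at hx
    rw [Finset.mem_coe, Finset.mem_filter, Finset.mem_range, ev_inv_ev u (by omega)]
    exact ⟨ev_lt _ _, hx⟩
  · intro x hx
    exact ev_ev_inv u (Finset.mem_range.1 (Finset.mem_filter.1 hx).1)
  · intro x hx
    rw [Finset.mem_coe, Finset.mem_range] at hx
    exact ev_inv_ev u (by omega)

lemma Sorted.sRefl_mul {u : Equiv.Perm (Fin (2*m+2))} (h : Sorted m kk u) (hu : u ∈ Weyl m)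
    (hkm : kk ≤ m) {i : ℕ} (h1 : 1 ≤ i) (h2 : i ≤ m+1)
    (hi : (ev m u⁻¹ (i-1) < kk ∧ kk ≤ ev m u⁻¹ i) ∨
      (ev m u⁻¹ (2*m+1-i) < kk ∧ kk ≤ ev m u⁻¹ (2*m+2-i))) :
    Sorted m kk (sRefl m i * u) := by
  intro j hj1 hj2 hjk
  have hlt := h j hj1 hj2 hjk
  unfold Asc at hlt ⊢
  have pa := ev_inv_ev u (j := j-1) (by omega)
  have pb := ev_inv_ev u (j := j) (by omega)
  have la := ev_lt u (j-1)
  have lb := ev_lt u j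
  rw [ev_mul, ev_mul]
  generalize ev m u (j-1) = a at *
  generalize ev m u j = b at *
  have b1 := ev_bar (inv_mem hu) (i := i-1) (j := 2*m+2-i) (by omega)
  have b2 := ev_bar (inv_mem hu) (i := i) (j := 2*m+1-i) (by omega)
  have n1 : ¬ (a = i-1 ∧ b = i) := by
    rintro ⟨rfl, rfl⟩
    omega
  have n2 : ¬ (a = 2*m+1-i ∧ b = 2*m+2-i) := by
    rintro ⟨rfl, rfl⟩
    omega
  rcases Nat.lt_or_ge m i with hm | hm
  · obtain rfl : i = m+1 := by omega
    rw [ev_sRefl_last la, ev_sRefl_last lb]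
    split_ifs <;> omega
  · rw [ev_sRefl h1 hm la, ev_sRefl h1 hm lb]
    clear pa pb b1 b2 hi
    split_ifs <;> omega

lemma exists_threshold {p : ℕ → Prop} {l h : ℕ} (hlh : l ≤ h)
    (hp : ∀ x, l ≤ x → x + 1 < h → p x → p (x+1)) :
    ∃ a, l ≤ a ∧ a ≤ h ∧ ∀ x, l ≤ x → x < h → (p x ↔ a ≤ x) := by
  induction h, hlh using Nat.le_induction with
  | base => exact ⟨l, le_rfl, le_rfl, fun x h1 h2 => by omega⟩
  | succ h hlh ih =>
    obtain ⟨a, h1, h2, h3⟩ := ih (fun x hx1 hx2 => hp x hx1 (by omega))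
    by_cases hh : p h
    · refine ⟨a, h1, by omega, fun x hx1 hx2 => ?_⟩
      rcases Nat.lt_or_ge x h with hx | hx
      · exact h3 x hx1 hx
      · obtain rfl : x = h := by omega
        exact ⟨fun _ => h2, fun _ => hh⟩
    · refine ⟨h+1, by omega, le_rfl, fun x hx1 hx2 => ?_⟩
      refine ⟨fun hx => absurd ?_ hh, fun hx => by omega⟩
      have hup : ∀ y, x ≤ y → y ≤ h → p y := by
        intro y hy
        induction y, hy using Nat.le_induction with
        | base => exact fun _ => hx
        | succ y hy ihy => exact fun hyh => hp y (by omega) (by omega) (ihy (by omega))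
      exact hup h (by omega) le_rfl

/-- Left multiplication by a simple reflection raising one of the first `kk` values. -/
lemma IsCandidate.sRefl_mul {u : Equiv.Perm (Fin (2*m+2))} (h : IsCandidate m kk d u)
    (hkm : kk ≤ m) {i : ℕ} (h1 : 2 ≤ i) (h2 : i ≤ m+1)
    (hi : (ev m u⁻¹ (i-1) < kk ∧ kk ≤ ev m u⁻¹ i) ∨
      (ev m u⁻¹ (2*m+1-i) < kk ∧ kk ≤ ev m u⁻¹ (2*m+2-i)))
    (hc : i = kk → kk ≤ ev m u⁻¹ (kk-1) ∨
      kk + 1 ≤ d + ((Finset.range kk).filter (fun x => ev m u⁻¹ x < kk)).card) :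
    IsCandidate m kk d (sRefl m i * u) ∧ bruhatLE m u (sRefl m i * u) ∧
      len m u < len m (sRefl m i * u) := by
  have hs : (sRefl m i)⁻¹ = sRefl m i := sRefl_inv (by omega) h2
  have hss : ∀ x < 2*m+2, ev m (sRefl m i) (ev m (sRefl m i) x) = x := fun x hx => by
    rw [← ev_mul, sRefl_mul_self (by omega) h2, ev_one hx]
  have hfix : ∀ x < kk, x + 1 ≠ i → x ≠ i → ev m (sRefl m i) x = x := fun x hx c1 c2 => by
    rcases Nat.lt_or_ge m i with hm | hm
    · obtain rfl : i = m+1 := by omega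
      rw [ev_sRefl_last (by omega), if_neg (by omega), if_neg (by omega)]
    · rw [ev_sRefl (by omega) hm (by omega), if_neg (by omega), if_neg (by omega),
        if_neg (by omega), if_neg (by omega)]
  have hend : ev m (sRefl m i) 0 = 0 ∧ ev m (sRefl m i) (2*m+1) = 2*m+1 := by
    rcases Nat.lt_or_ge m i with hm | hm
    · obtain rfl : i = m+1 := by omega
      constructor <;> rw [ev_sRefl_last (by omega), if_neg (by omega), if_neg (by omega)]
    · rw [ev_sRefl (by omega) hm (by omega), ev_sRefl (by omega) hm (by omega)]
      constructor <;> split_ifs <;> omega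
  have hasc : Asc m u⁻¹ i := by
    have b1 := ev_bar (inv_mem h.mem_Weyl) (i := i-1) (j := 2*m+2-i) (by omega)
    have b2 := ev_bar (inv_mem h.mem_Weyl) (i := i) (j := 2*m+1-i) (by omega)
    unfold Asc
    omega
  refine ⟨⟨mul_mem (sRefl_mem_Weyl (by omega) h2) h.mem_Weyl,
    h.sorted.sRefl_mul h.mem_Weyl hkm (by omega) h2 hi, ?_, ?_, ?_⟩,
    bruhatLE_mul_left h.mem_Weyl (sRefl_mem_reflections (by omega) h2)
      ((len_lt_len_mul_sRefl_iff (inv_mem h.mem_Weyl) (by omega) h2).2 hasc) hs⟩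
  · rw [mul_inv_rev, hs, ev_mul, hend.1]
    exact h.zero
  · rw [mul_inv_rev, hs, ev_mul, hend.2]
    exact h.last
  · have hcard := h.card
    simp only [mul_inv_rev, hs, ev_mul]
    have inj : ∀ s : Finset ℕ, (∀ x ∈ s, x < 2*m+2) → Set.InjOn (ev m (sRefl m i)) s :=
      fun s hsx x hx y hy hxy => (ev_inj _ (hsx x hx) (hsx y hy)).1 hxy
    by_cases hik : i = kk
    · have hsub : ((Finset.range kk).filter (fun x => ev m u⁻¹ x < kk)).erase (kk-1) ⊆
          (Finset.range kk).filter (fun x => ev m u⁻¹ (ev m (sRefl m i) x) < kk) := by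
        intro x hx
        rw [Finset.mem_erase, Finset.mem_filter, Finset.mem_range] at hx
        rw [Finset.mem_filter, Finset.mem_range, hfix x hx.2.1 (by omega) (by omega)]
        exact hx.2
      have hle := Finset.card_le_card hsub
      rcases hc hik with hc | hc
      · rw [Finset.erase_eq_of_notMem] at hle
        · omega
        · rw [Finset.mem_filter]
          omega
      · have := Finset.pred_card_le_card_erase
          (s := (Finset.range kk).filter (fun x => ev m u⁻¹ x < kk)) (a := kk-1)
        omega
    · have hle : ((Finset.range kk).filter (fun x => ev m u⁻¹ x < kk)).card ≤
          ((Finset.range kk).filter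
            (fun x => ev m u⁻¹ (ev m (sRefl m i) x) < kk)).card := by
        refine Finset.card_le_card_of_injOn (ev m (sRefl m i)) ?_ (inj _ ?_)
        · intro x hx
          rw [Finset.mem_coe, Finset.mem_filter, Finset.mem_range] at hx
          rw [Finset.mem_coe, Finset.mem_filter, Finset.mem_range, hss x (by omega)]
          refine ⟨?_, hx.2⟩
          rcases Nat.lt_or_ge i kk with c | c
          · rw [ev_sRefl (by omega) (by omega) (by omega)]
            split_ifs <;> omega
          · rw [hfix x hx.1 (by omega) (by omega)]
            exact hx.1
        · intro x hx
          rw [Finset.mem_filter, Finset.mem_range] at hx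
          omega
      omega

/-- Left multiplication by the reflection exchanging the values `d-1` and `kk`. -/
lemma IsCandidate.refl_mul {u : Equiv.Perm (Fin (2*m+2))} (h : IsCandidate m kk d u)
    (hkm : kk ≤ m) (h2 : 2 ≤ d) (hdk : d < kk)
    (hlow : ∀ x, 1 ≤ x → x < kk → (ev m u⁻¹ x < kk ↔ d ≤ x))
    (hbk : ev m u⁻¹ (2*m+1-kk) < kk)
    (hbd : ∀ x, 2*m+2-kk ≤ x → x ≤ 2*m+2-d → kk ≤ ev m u⁻¹ x) :
    ∃ t, IsCandidate m kk d (t * u) ∧ bruhatLE m u (t * u) ∧ len m u < len m (t * u) := by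
  have hv : (PosRoot.tm d (kk+1)).valid m := ⟨by omega, by omega, by omega⟩
  have hinv := refl_tm_inv hv
  have htW := refl_mem_Weyl hv
  have ht : ∀ x < 2*m+2, ev m ((PosRoot.tm d (kk+1)).refl m) x = if x = d-1 then kk else
      if x = kk then d-1 else if x = 2*m+2-d then 2*m+1-kk else
      if x = 2*m+1-kk then 2*m+2-d else x := fun x hx => by
    rw [ev_refl_tm hv hx, Nat.add_sub_cancel, show 2*m+2-(kk+1) = 2*m+1-kk by omega]
  have hW := h.mem_Weyl
  have b1 := ev_bar (inv_mem hW) (i := d-1) (j := 2*m+2-d) (by omega)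
  have b2 := ev_bar (inv_mem hW) (i := kk) (j := 2*m+1-kk) (by omega)
  have hd1 := hlow (d-1) (by omega) (by omega)
  have hbd' := hbd (2*m+2-d) (by omega) (by omega)
  have htr := refl_tm_mem_reflections (m := m) (p := d) (q := kk+1) (by omega) (by omega) (by omega)
  have hasc := len_lt_len_mul_refl_tm (m := m) (p := d) (q := kk+1) (by omega) (by omega)
    (by omega) (inv_mem hW) (by rw [Nat.add_sub_cancel]; omega)
  generalize (PosRoot.tm d (kk+1)).refl m = t at *
  refine ⟨t, ⟨mul_mem htW hW, ?_, ?_, ?_, ?_⟩, bruhatLE_mul_left hW htr hasc hinv⟩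
  · intro j hj1 hj2 hjk
    have hlt := h.sorted j hj1 hj2 hjk
    unfold Asc at hlt ⊢
    have pa := ev_inv_ev u (j := j-1) (by omega)
    have pb := ev_inv_ev u (j := j) (by omega)
    have la := ev_lt u (j-1)
    have lb := ev_lt u j
    rcases Nat.lt_or_ge j kk with hj | hj
    · rw [ev_mul, ev_mul]
      generalize ev m u (j-1) = a at *
      generalize ev m u j = b at *
      have nb : ∀ x, ev m u⁻¹ x < kk → x ≠ d-1 ∧ x ≠ kk ∧ x ≠ 2*m+2-d := by
        intro x hx
        refine ⟨?_, ?_, ?_⟩ <;> rintro rfl <;> omega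
      obtain ⟨a1, a2, a3⟩ := nb a (by omega)
      obtain ⟨c1, c2, c3⟩ := nb b (by omega)
      have hb' : ¬ (2*m+2-kk ≤ b ∧ b ≤ 2*m+2-d) := fun hb => by
        have := hbd b hb.1 hb.2
        omega
      rw [ht a la, ht b lb, if_neg a1, if_neg a2, if_neg a3, if_neg c1, if_neg c2, if_neg c3]
      split_ifs <;> omega
    · have hla := h.sorted.high_le hW (j := j-1) (by omega) (by omega)
      rcases Nat.lt_or_ge m j with hjm | hjm
      · obtain rfl : j = m+1 := by omega
        have hbar := ev_bar (mul_mem htW hW) (i := m) (j := m+1) (by omega)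
        rw [Nat.add_sub_cancel] at hla ⊢
        have : ev m (t * u) m ≤ m := by
          rw [ev_mul, ht _ (ev_lt _ _)]
          split_ifs <;> omega
        omega
      · have hlb := h.sorted.high_le hW (j := j) (by omega) (by omega)
        rw [ev_mul, ev_mul]
        generalize ev m u (j-1) = a at *
        generalize ev m u j = b at *
        have a2 : a ≠ kk := by rintro rfl; omega
        have c2 : b ≠ kk := by rintro rfl; omega
        have hb' : ¬ (d ≤ b ∧ b < kk) := fun hb => by
          have := (hlow b (by omega) hb.2).2 hb.1
          omega
        rw [ht a la, ht b lb]
        split_ifs <;> omega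
  · rw [mul_inv_rev, hinv, ev_mul, ht _ (by omega)]
    have := h.zero
    rw [if_neg (by omega), if_neg (by omega), if_neg (by omega), if_neg (by omega)]
    exact this
  · rw [mul_inv_rev, hinv, ev_mul, ht _ (by omega)]
    have := h.last
    rw [if_neg (by omega), if_neg (by omega), if_neg (by omega), if_neg (by omega)]
    exact this
  · refine h.card.trans (Nat.add_le_add_left (Finset.card_le_card ?_) d)
    intro x hx
    rw [Finset.mem_filter, Finset.mem_range] at hx ⊢
    have hx0 : x ≠ 0 := by
      rintro rfl
      have := h.zero
      omega
    have hdx := (hlow x (by omega) hx.1).1 hx.2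
    rw [mul_inv_rev, hinv, ev_mul, ht _ (by omega), if_neg (by omega), if_neg (by omega),
      if_neg (by omega), if_neg (by omega)]
    exact hx

lemma IsCandidate.eq_or_lt {u : Equiv.Perm (Fin (2*m+2))} (h : IsCandidate m kk d u)
    (hk : 1 ≤ kk) (hkm : kk ≤ m) (hd : 1 ≤ d) (hdk : d ≤ kk) :
    (∀ x < 2*m+2, (fn m x ∈ valSet m kk u ↔ InTop m kk d x)) ∨
      ∃ u', IsCandidate m kk d u' ∧ bruhatLE m u u' ∧ len m u < len m u' := by
  rw [or_iff_not_imp_right]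
  intro hno
  have hno1 : ∀ i, 2 ≤ i → i ≤ m+1 →
      (i = kk → kk ≤ ev m u⁻¹ (kk-1) ∨
        kk + 1 ≤ d + ((Finset.range kk).filter (fun x => ev m u⁻¹ x < kk)).card) →
      (ev m u⁻¹ (i-1) < kk → ev m u⁻¹ i < kk) ∧
      (ev m u⁻¹ (2*m+1-i) < kk → ev m u⁻¹ (2*m+2-i) < kk) := by
    intro i h1 h2 hc
    by_contra hcon
    exact hno ⟨_, h.sRefl_mul hkm h1 h2 (by omega) hc⟩
  have hno2 := fun h2 hdk hlow hbk hbd => hno ((h.refl_mul hkm h2 hdk hlow hbk hbd).elim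
    fun t ht => ⟨_, ht⟩)
  have iso : ∀ x < 2*m+2, ev m u⁻¹ x < kk → ¬ ev m u⁻¹ (2*m+1-x) < kk := by
    intro x hx hx1 hx2
    have := ev_bar (inv_mem h.mem_Weyl) (i := x) (j := 2*m+1-x) (by omega)
    omega
  have h0 := h.zero
  have hl := h.last
  have hcard := h.card
  have htot := card_filter_ev_inv_lt (u := u) hkm
  suffices ∀ x < 2*m+2, (ev m u⁻¹ x < kk ↔ InTop m kk d x) from fun x hx => by
    rw [← ev_inv_lt_iff hkm hx, this x hx]
  obtain ⟨a, a1, a2, ha⟩ := exists_threshold (p := fun x => ev m u⁻¹ x < kk) (l := 1) (h := kk) hk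
    (fun x hx1 hx2 hx => (hno1 (x+1) (by omega) (by omega) (by omega)).1 hx)
  obtain ⟨e, e1, e2, he⟩ := exists_threshold (p := fun x => ev m u⁻¹ x < kk) (l := m)
    (h := 2*m+2-kk) (by omega) (fun x hx1 hx2 hx => by
      have := (hno1 (2*m+1-x) (by omega) (by omega) (by omega)).2
      rw [show 2*m+1-(2*m+1-x) = x by omega, show 2*m+2-(2*m+1-x) = x+1 by omega] at this
      exact this hx)
  obtain ⟨f, f1, f2, hf⟩ := exists_threshold (p := fun x => ev m u⁻¹ x < kk) (l := 2*m+2-kk)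
    (h := 2*m+1) (by omega) (fun x hx1 hx2 hx => by
      have := (hno1 (2*m+1-x) (by omega) (by omega) (by omega)).2
      rw [show 2*m+1-(2*m+1-x) = x by omega, show 2*m+2-(2*m+1-x) = x+1 by omega] at this
      exact this hx)
  obtain ⟨c, c1, c2, hc⟩ := exists_threshold (p := fun x => ev m u⁻¹ x < kk) (l := kk)
    (h := m+1) (by omega)
    (fun x hx1 hx2 hx => (hno1 (x+1) (by omega) (by omega) (by omega)).1 hx)
  have hm : ¬ ev m u⁻¹ m < kk := fun hm => by
    have g1 := (hno1 (m+1) (by omega) le_rfl (by omega)).1 hm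
    have g2 := iso m (by omega) hm
    rw [show 2*m+1-m = m+1 by omega] at g2
    exact g2 g1
  obtain rfl : c = m+1 := by
    have := (hc m hkm (by omega)).not.1 hm
    omega
  have hem : m < e := by
    have := (he m le_rfl (by omega)).not.1 hm
    omega
  have hP : ∀ x < 2*m+2, (ev m u⁻¹ x < kk ↔
      (a ≤ x ∧ x < kk) ∨ (e ≤ x ∧ x < 2*m+2-kk) ∨ (f ≤ x ∧ x < 2*m+1)) := by
    intro x hx
    rcases Nat.eq_zero_or_pos x with rfl | hx0
    · omega
    rcases Nat.lt_or_ge x kk with hxk | hxk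
    · have := ha x hx0 hxk
      omega
    rcases Nat.lt_or_ge x (m+1) with hxm | hxm
    · have := hc x hxk hxm
      omega
    rcases Nat.lt_or_ge x (2*m+2-kk) with hxe | hxe
    · have := he x (by omega) hxe
      omega
    rcases Nat.lt_or_ge x (2*m+1) with hxf | hxf
    · have := hf x hxe hxf
      omega
    · obtain rfl : x = 2*m+1 := by omega
      omega
  have hlowcard : ((Finset.range kk).filter (fun x => ev m u⁻¹ x < kk)).card = kk - a := by
    rw [← Nat.card_Ico]
    congr 1
    ext x
    rw [Finset.mem_filter, Finset.mem_range, Finset.mem_Ico]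
    constructor
    · intro hx
      have := (hP x (by omega)).1 hx.2
      omega
    · intro hx
      exact ⟨hx.2, (hP x (by omega)).2 (Or.inl hx)⟩
  have hsum : (kk - a) + ((2*m+2-kk-e) + (2*m+1-f)) = kk := by
    refine Eq.trans ?_ htot
    rw [← Nat.card_Ico a kk, ← Nat.card_Ico e (2*m+2-kk), ← Nat.card_Ico f (2*m+1),
      ← Finset.card_union_of_disjoint, ← Finset.card_union_of_disjoint]
    · congr 1
      ext x
      simp only [Finset.mem_filter, Finset.mem_range, Finset.mem_union, Finset.mem_Ico]
      constructor
      · intro hx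
        have hx2 : x < 2*m+2 := by omega
        exact ⟨hx2, (hP x hx2).2 hx⟩
      · intro hx
        exact (hP x hx.1).1 hx.2
    · rw [Finset.disjoint_left]
      intro x hx
      simp only [Finset.mem_union, Finset.mem_Ico] at hx ⊢
      omega
    · rw [Finset.disjoint_left]
      intro x hx
      simp only [Finset.mem_Ico] at hx ⊢
      omega
  have hfa : 2*m+2 ≤ f + a := by
    by_contra hcon
    have g1 := (hP a (by omega)).2 (by omega)
    have g2 := (hP (2*m+1-a) (by omega)).2 (by omega)
    exact iso a (by omega) g1 g2
  rw [hlowcard] at hcard hno1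
  have hbk : ev m u⁻¹ (2*m+1-kk) < kk := (hP _ (by omega)).2 (by omega)
  rcases Nat.lt_or_ge a kk with hak | hak
  · have g1 := (hP (kk-1) (by omega)).2 (by omega)
    have g2 := (hP kk (by omega)).not.2 (by omega)
    have had : a = d := by
      by_contra hcon
      exact g2 ((hno1 kk (by omega) (by omega) (by omega)).1 g1)
    subst had
    have hff : f + a = 2*m+2 := by
      by_contra hcon
      refine hno2 (by omega) hak (fun x hx1 hx2 => ha x hx1 hx2) hbk (fun x hx1 hx2 => ?_)
      have := (hP x (by omega)).not.2 (by omega)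
      omega
    intro x hx
    rw [hP x hx]
    unfold InTop
    omega
  · have g1 := (hP (kk-1) (by omega)).not.2 (by omega)
    have hfk : f + kk = 2*m+2 := by
      rcases Nat.lt_or_ge kk 2 with hk2 | hk2
      · omega
      · have g2 := (hno1 kk hk2 (by omega) (by omega)).2 hbk
        have g3 := (hP _ (by omega)).1 g2
        omega
    intro x hx
    rw [hP x hx]
    unfold InTop
    omega

lemma IsCandidate.bruhatLE {u v : Equiv.Perm (Fin (2*m+2))} (h : IsCandidate m kk d u)
    (hk : 1 ≤ kk) (hkm : kk ≤ m) (hd : 1 ≤ d) (hdk : d ≤ kk) (hv : v ∈ Weyl m)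
    (sv : Sorted m kk v) (hvs : ∀ x < 2*m+2, (fn m x ∈ valSet m kk v ↔ InTop m kk d x)) :
    bruhatLE m u v := by
  generalize hN : Finset.univ.sup (len m) - len m u = N
  induction N using Nat.strong_induction_on generalizing u with
  | _ N ih =>
    rcases h.eq_or_lt hk hkm hd hdk with hu | ⟨u', h1, h2, h3⟩
    · have : u = v := h.sorted.eq_of_valSet_eq hkm h.mem_Weyl hv sv
        ((valSet_eq_iff u v).2 fun x hx => by rw [hu x hx, hvs x hx])
      rw [this]
      exact Relation.ReflTransGen.refl
    · have hle : len m u' ≤ Finset.univ.sup (len m) := Finset.le_sup (Finset.mem_univ u')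
      exact h2.trans (ih _ (by omega) h1 rfl)

lemma isCandidate_of_chainO {u : Equiv.Perm (Fin (2*m+2))} (hkm : kk ≤ m)
    (hu : isMinRep m kk u) (ho : isOdd m u) (h0 : u (fn m 0) ≠ fn m 0)
    (h : ChainO m kk 1 u d) : IsCandidate m kk d u := by
  have hz : kk ≤ ev m u⁻¹ 0 := by
    by_contra hc
    have e1 := ev_ev_inv u (j := 0) (by omega)
    refine h0 ?_
    rw [← fn_ev]
    congr 1
    rcases Nat.eq_zero_or_pos (ev m u⁻¹ 0) with hp | hp
    · rwa [hp] at e1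
    · have := hu.sorted.lt_low hkm hp (by omega)
      omega
  have hl : kk ≤ ev m u⁻¹ (2*m+1) := by
    by_contra hc
    refine ho (fn m (ev m u⁻¹ (2*m+1))) ?_ ?_
    · rw [fn_val (by omega)]
      omega
    · rw [← fn_ev, ev_ev_inv u (by omega)]
  refine ⟨hu.1, hu.sorted, hz, hl, ?_⟩
  have hc := h.card_valSet_sdiff_le hkm
  have hcu : (valSet m kk u).card = kk := by
    refine Eq.trans ?_ (card_filter_ev_inv_lt (u := u) hkm)
    refine (Finset.card_nbij (fn m) ?_ ?_ ?_).symm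
    · intro x hx
      rw [Finset.mem_coe, Finset.mem_filter, Finset.mem_range] at hx
      exact (ev_inv_lt_iff hkm hx.1).1 hx.2
    · intro x hx y hy hxy
      rw [Finset.mem_coe, Finset.mem_filter, Finset.mem_range] at hx hy
      exact (fn_inj hx.1 hy.1).1 hxy
    · intro x hx
      refine ⟨x, ?_, fn_coe x⟩
      rw [Finset.mem_coe, Finset.mem_filter, Finset.mem_range, ev_inv_lt_iff hkm x.isLt, fn_coe]
      exact ⟨x.isLt, hx⟩
  have hinter : (valSet m kk u ∩ valSet m kk 1).card ≤
      ((Finset.range kk).filter (fun x => ev m u⁻¹ x < kk)).card := by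
    refine Finset.card_le_card_of_injOn (fun x => (x : ℕ)) ?_ (fun x _ y _ hxy => Fin.ext hxy)
    intro x hx
    rw [Finset.mem_coe, Finset.mem_inter] at hx
    rw [Finset.mem_coe, Finset.mem_filter, Finset.mem_range, ev_inv_lt_iff hkm x.isLt, fn_coe]
    refine ⟨?_, hx.1⟩
    have h1 := hx.2
    rw [← fn_coe x, mem_valSet hkm x.isLt] at h1
    obtain ⟨j, hj, hjx⟩ := h1
    rw [ev_one (by omega)] at hjx
    rwa [hjx] at hj
  have := Finset.card_sdiff_add_card_inter (valSet m kk u) (valSet m kk 1)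
  omega

end Maximal

/-- For `1 ≤ d ≤ k < n+1`, the set `A_Z(d)` of `u ∈ W^P ∩ W^{odd}`
with `u(1) ≠ 1` joined to `id W_P` by a degree `d` chain in the moment graph of
`IG(k, 2n+1)` has a Bruhat-maximal element, namely the minimal length representative
`vd` of `O_Y(d) W_P`, whose values are
`(d+1 < ⋯ < k < bar(k+1) < bar d < ⋯ < bar 2)` (with the convention that the
corresponding ranges are empty for `d = 1` resp. `d = k`). -/
theorem statement10 (n k : ℕ) (hn : 1 ≤ n) (hk : 1 ≤ k) (hk' : k < n+1)
    (d : ℕ) (hd : 1 ≤ d) (hdk : d ≤ k)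
    (vd : Equiv.Perm (Fin (2*n+2))) (hvd : isMinRep n k vd)
    (hvdc : cosetEq n k vd (mulOY n k 1 d)) :
    (isOdd n vd ∧ vd (fn n 0) ≠ fn n 0 ∧ ChainO n k 1 vd d) ∧
    (∀ u, isMinRep n k u → isOdd n u → u (fn n 0) ≠ fn n 0 →
      ChainO n k 1 u d → bruhatLE n u vd) ∧
    valSet n k vd =
      ((Finset.Icc (d+1) k).image (fun i => fn n (i-1))) ∪
      insert (fn n (2*n+2-(k+1)))
        ((Finset.Icc 2 d).image (fun i => fn n (2*n+2-i))) := by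
  have hkn : k ≤ n := by omega
  have hvs : ∀ x < 2*n+2, (fn n x ∈ valSet n k vd ↔ InTop n k d x) := fun x hx => by
    rw [valSet_eq_of_cosetEq hkn hvdc,
      (isOYState_mulOY hk hkn hd hdk).mem_valSet_iff hkn hd hdk hx]
  refine ⟨⟨hvd.sorted.isOdd hvd.1 hkn ?_, fun h0 => ?_, chainO_of_valSet hkn hd hdk hvd hvs⟩,
    fun u hu ho h0 hc => (isCandidate_of_chainO hkn hu ho h0 hc).bruhatLE hk hkn hd hdk
      hvd.1 hvd.sorted hvs, ?_⟩
  · rw [hvs _ (by omega)]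
    unfold InTop
    omega
  · have h1 : InTop n k d 0 := (hvs 0 (by omega)).1 ((mem_valSet hkn (by omega)).2
      ⟨0, hk, by rw [ev, h0, fn_val (by omega)]⟩)
    unfold InTop at h1
    omega
  · ext x
    rw [← fn_coe x, hvs _ x.isLt]
    have hx := x.isLt
    generalize (x : ℕ) = y at hx
    simp only [Finset.mem_union, Finset.mem_insert, Finset.mem_image, Finset.mem_Icc]
    rw [fn_inj hx (by omega)]
    unfold InTop
    constructor
    · rintro (h | h | h)
      · exact Or.inl ⟨y+1, by omega, by rw [Nat.add_sub_cancel]⟩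
      · exact Or.inr (Or.inl (by omega))
      · exact Or.inr (Or.inr ⟨2*n+2-y, by omega, by congr 1; omega⟩)
    · rintro (⟨i, hi, h⟩ | h | ⟨i, hi, h⟩)
      · rw [fn_inj (by omega) hx] at h
        omega
      · omega
      · rw [fn_inj (by omega) hx] at h
        omega

end
end OddSymplectic
end

section
/- Let λ ∈ BC(k,2n+1) with λ_1 = 2n+1−k, and let d_1, d_2 ≥ 1. Then λ ∈ Comp_BC(d_1 + d_2) if and only if λ^{O_Z(d_1)} ∈ Comp_BC(d_2). -/
/-!
Common framework: the Weyl group of type `C_{m+1}` realized as signed permutations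
of `Fin (2*m+2)` (values 0-indexed: the paper's 1-indexed value `a ∈ {1, …, 2m+2}`
corresponds to `a-1`, and the paper's `bar a = 2m+3-a` corresponds to `2m+2-a`).
For the odd symplectic Grassmannian `IG(k, 2n+1)` one takes `m = n`;
the smaller group `W_{2n}` of type `C_n` corresponds to `m = n-1`.
-/

namespace OddSymplectic

open Equiv

noncomputable section

theorem IsPart.antitone {k N : ℕ} {μ : ℕ → ℤ} (h : IsPart k N μ) {i j : ℕ}
    (hi : 1 ≤ i) (hij : i ≤ j) : μ j ≤ μ i := by
  obtain ⟨hmono, -, hnn, hz⟩ := h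
  induction j, hij using Nat.le_induction with
  | base => exact le_rfl
  | succ j hij ih =>
    rcases Nat.lt_or_ge j k with hj | hj
    · exact (hmono j (by omega) hj).trans ih
    · rw [hz (j + 1) (Or.inr (by omega))]
      rcases Nat.lt_or_ge k i with hik | hik
      · rw [hz i (Or.inr hik)]
      · exact hnn i hi hik

theorem IsPart.nonneg {k N : ℕ} {μ : ℕ → ℤ} (h : IsPart k N μ) (j : ℕ) : 0 ≤ μ j := by
  by_cases hj : j = 0 ∨ k < j
  · rw [h.2.2.2 j hj]
  · exact h.2.2.1 j (by omega) (by omega)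

theorem IsPart.le_numParts_iff {k N : ℕ} {μ : ℕ → ℤ} (h : IsPart k N μ) {j : ℕ}
    (hj : 1 ≤ j) : j ≤ numParts k μ ↔ 1 ≤ μ j := by
  constructor
  · intro hle
    by_contra hlt
    have hsub : (Finset.Icc 1 k).filter (fun i => μ i ≠ 0) ⊆ Finset.Icc 1 (j - 1) := by
      intro i hi
      simp only [Finset.mem_filter, Finset.mem_Icc] at hi ⊢
      by_contra hcon
      have h1 := h.antitone hj (show j ≤ i by omega)
      have h2 := h.nonneg i
      omega
    have hcard := Finset.card_le_card hsub
    simp only [Nat.card_Icc] at hcard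
    unfold numParts at hle
    omega
  · intro hpos
    have hsub : Finset.Icc 1 j ⊆ (Finset.Icc 1 k).filter (fun i => μ i ≠ 0) := by
      intro i hi
      simp only [Finset.mem_filter, Finset.mem_Icc] at hi ⊢
      have h1 := h.antitone hi.1 hi.2
      refine ⟨⟨hi.1, ?_⟩, by omega⟩
      by_contra hcon
      have h2 := h.2.2.2 i (Or.inr (by omega))
      omega
    have hcard := Finset.card_le_card hsub
    simp only [Nat.card_Icc] at hcard
    unfold numParts
    omega

@[simp]
theorem OZ1_one (k : ℕ) (lam : ℕ → ℤ) : OZ1 k lam 1 = lam 1 := by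
  simp [OZ1]

theorem OZ1_of_two_le {k N : ℕ} {lam : ℕ → ℤ} (h : IsPart k N lam) {j : ℕ} (hj : 2 ≤ j) :
    OZ1 k lam j = max (lam (j + 1) - 1) 0 := by
  have hl := h.le_numParts_iff (show 1 ≤ j + 1 by omega)
  unfold OZ1
  split_ifs <;> omega

theorem IsPart.OZ1 {k N : ℕ} {lam : ℕ → ℤ} (h : IsPart k N lam) :
    IsPart k N (OZ1 k lam) := by
  refine ⟨?_, by simpa using h.2.1, ?_, ?_⟩
  · intro j hj hjk
    rw [OZ1_of_two_le h (show 2 ≤ j + 1 by omega)]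
    have h1 := h.antitone hj (show j ≤ j + 1 + 1 by omega)
    have h2 := h.nonneg j
    rcases Nat.lt_or_ge 1 j with h3 | h3
    · rw [OZ1_of_two_le h h3]
      have h4 := h.antitone (show 1 ≤ j + 1 by omega) (show j + 1 ≤ j + 1 + 1 by omega)
      omega
    · obtain rfl : j = 1 := by omega
      rw [OZ1_one]
      omega
  · intro j hj hjk
    rcases Nat.lt_or_ge 1 j with h3 | h3
    · rw [OZ1_of_two_le h h3]
      exact le_max_right _ _
    · obtain rfl : j = 1 := by omega
      rw [OZ1_one]
      exact h.nonneg 1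
  · rintro j (rfl | hj)
    · simp [OddSymplectic.OZ1]
    · rcases Nat.lt_or_ge 1 j with h3 | h3
      · rw [OZ1_of_two_le h h3, h.2.2.2 (j + 1) (Or.inr (by omega))]
        rfl
      · obtain rfl | rfl : j = 0 ∨ j = 1 := by omega
        · simp [OddSymplectic.OZ1]
        · rw [OZ1_one]
          exact h.2.2.2 1 (Or.inr hj)

/-- No two vertical steps of `D(λ + 1^k)` sit in mirror positions; here in terms of the parts. -/
theorem isBCodd_iff {n k : ℕ} (hk : 1 ≤ k) {lam : ℕ → ℤ} :
    IsBCodd n k lam ↔ IsPart k (2*n+1) lam ∧ ∀ i j, 1 ≤ i → i ≤ k → 1 ≤ j → j ≤ k →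
      lam i + lam j ≠ 2*(n:ℤ) - 2*k - 1 + i + j := by
  have hadd : ∀ j, 1 ≤ j → j ≤ k → addOne k lam j = lam j + 1 :=
    fun j h1 h2 => if_pos ⟨h1, h2⟩
  constructor
  · rintro ⟨hp, -, hD⟩
    refine ⟨hp, ?_⟩
    have key : ∀ i j, 1 ≤ i → i ≤ k → 1 ≤ j → j ≤ k →
        2*(n:ℤ) + 1 - k - lam i + i ≤ n + 1 →
        lam i + lam j ≠ 2*(n:ℤ) - 2*k - 1 + i + j := by
      intro i j hi hik hj hjk hle heq
      have h1 := hp.antitone le_rfl hi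
      have h2 := hp.2.1
      push_cast at h2
      obtain ⟨t, ht⟩ := Int.eq_ofNat_of_zero_le
        (show 0 ≤ 2*(n:ℤ) + 1 - k - lam i + i by omega)
      refine hD t (by omega) (by omega) ⟨⟨i, hi, hik, ?_⟩, ⟨j, hj, hjk, ?_⟩⟩
      · rw [hadd i hi hik]
        push_cast
        omega
      · rw [hadd j hj hjk]
        have : ((2*n+3-t : ℕ) : ℤ) = 2*n+3-t := by omega
        rw [this]
        push_cast
        omega
    intro i j hi hik hj hjk heq
    by_cases hle : 2*(n:ℤ) + 1 - k - lam i + i ≤ n + 1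
    · exact key i j hi hik hj hjk hle heq
    · exact key j i hj hjk hi hik (by omega) (by omega)
  · rintro ⟨hp, hne⟩
    refine ⟨hp, ⟨?_, ?_, ?_, ?_⟩, ?_⟩
    · intro j hj hjk
      rw [hadd j hj hjk.le, hadd (j + 1) (by omega) hjk]
      have := hp.1 j hj hjk
      omega
    · rw [hadd 1 le_rfl hk]
      have := hp.2.1
      push_cast at this ⊢
      omega
    · intro j hj hjk
      rw [hadd j hj hjk]
      have := hp.nonneg j
      omega
    · intro j hj
      exact if_neg (by omega)
    · rintro t ht1 ht2 ⟨⟨i, hi, hik, h1⟩, ⟨j, hj, hjk, h2⟩⟩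
      rw [hadd i hi hik] at h1
      rw [hadd j hj hjk] at h2
      have : ((2*n+3-t : ℕ) : ℤ) = 2*n+3-t := by omega
      rw [this] at h2
      push_cast at h1 h2
      exact hne i j hi hik hj hjk (by omega)

theorem IsBCodd.OZ1 {n k : ℕ} (hk : 1 ≤ k) (hk' : k ≤ n+1) {lam : ℕ → ℤ}
    (h : IsBCodd n k lam) (h1 : lam 1 = 2*(n:ℤ)+1-k) : IsBCodd n k (OZ1 k lam) := by
  obtain ⟨hp, hne⟩ := (isBCodd_iff hk).1 h
  have bound : ∀ j, 1 ≤ j → j ≤ k → lam (j + 1) = 0 → 2 ≤ k →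
      lam 2 ≤ 2*(n:ℤ) - 2*k + 1 + j := by
    intro j hj hjk hz h2k
    induction hjk using Nat.decreasingInduction with
    | self =>
      have := hp.antitone le_rfl one_le_two
      omega
    | of_succ j hjk ih =>
      have h3 := hp.antitone (show 1 ≤ j + 1 by omega) (show j + 1 ≤ j + 1 + 1 by omega)
      have h4 := hp.nonneg (j + 1 + 1)
      have h5 := ih (by omega) (by omega)
      have h6 := hne 2 (j + 1) (by omega) h2k (by omega) (by omega)
      push_cast at h5 h6
      omega
  have lt_of_pos : ∀ i, 1 ≤ lam (i + 1) → i + 1 ≤ k := by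
    intro i hi
    by_contra hcon
    have := hp.2.2.2 (i + 1) (Or.inr (by omega))
    omega
  have mixed : ∀ i j : ℕ, 2 ≤ i → 2 ≤ j → j ≤ k → 1 ≤ lam (i + 1) → lam (j + 1) = 0 →
      lam (i + 1) ≠ 2*(n:ℤ) - 2*k + i + j := by
    intro i j hi hj hjk hpos hz
    have h3 := bound j (by omega) hjk hz (by omega)
    have h4 := hp.antitone one_le_two (show 2 ≤ i + 1 by omega)
    omega
  refine (isBCodd_iff hk).2 ⟨hp.OZ1, ?_⟩
  intro i j hi hik hj hjk heq
  rcases Nat.lt_or_ge 1 i with hi2 | hi2 <;> rcases Nat.lt_or_ge 1 j with hj2 | hj2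
  · rw [OZ1_of_two_le hp hi2, OZ1_of_two_le hp hj2] at heq
    have hi0 := hp.nonneg (i + 1)
    have hj0 := hp.nonneg (j + 1)
    by_cases hpi : 1 ≤ lam (i + 1) <;> by_cases hpj : 1 ≤ lam (j + 1)
    · have := hne (i + 1) (j + 1) (by omega) (lt_of_pos i hpi) (by omega) (lt_of_pos j hpj)
      push_cast at this
      omega
    · have := mixed i j hi2 hj2 hjk hpi (by omega)
      omega
    · have := mixed j i hj2 hi2 hik hpj (by omega)
      omega
    · omega
  · obtain rfl : j = 1 := by omega
    rw [OZ1_of_two_le hp hi2, OZ1_one] at heq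
    omega
  · obtain rfl : i = 1 := by omega
    rw [OZ1_of_two_le hp hj2, OZ1_one] at heq
    omega
  · obtain rfl : i = 1 := by omega
    obtain rfl : j = 1 := by omega
    rw [OZ1_one] at heq
    omega

@[simp]
theorem OZd_one (k : ℕ) (lam : ℕ → ℤ) (d : ℕ) : OZd k lam d 1 = lam 1 := by
  induction d with
  | zero => rfl
  | succ d ih => rw [OZd, OZ1_one, ih]

theorem IsPart.OZd {k N : ℕ} {lam : ℕ → ℤ} (h : IsPart k N lam) (d : ℕ) :
    IsPart k N (OZd k lam d) := by
  induction d with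
  | zero => exact h
  | succ d ih => exact ih.OZ1

theorem OZd_of_two_le {k N : ℕ} {lam : ℕ → ℤ} (h : IsPart k N lam) (d : ℕ) {j : ℕ}
    (hj : 2 ≤ j) : OZd k lam d j = max (lam (j + d) - d) 0 := by
  induction d generalizing j with
  | zero => simpa [OZd] using h.nonneg j
  | succ d ih =>
    rw [OZd, OZ1_of_two_le (h.OZd d) hj, ih (by omega), show j + 1 + d = j + (d + 1) by omega]
    push_cast
    omega

theorem IsBCodd.OZd {n k : ℕ} (hk : 1 ≤ k) (hk' : k ≤ n+1) {lam : ℕ → ℤ}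
    (h : IsBCodd n k lam) (h1 : lam 1 = 2*(n:ℤ)+1-k) (d : ℕ) :
    IsBCodd n k (OZd k lam d) := by
  induction d with
  | zero => exact h
  | succ d ih => exact ih.OZ1 hk hk' (by rw [OZd_one, h1])

theorem elld_OZd {k N : ℕ} {lam : ℕ → ℤ} (h : IsPart k N lam) {i : ℤ} (hi : 0 ≤ i)
    (d : ℕ) {e : ℕ} (he : 1 ≤ e) :
    elld k (OZd k lam d) i e = elld k lam (d + i) (d + e) := by
  refine Finset.card_bij (fun j _ => j + d) ?_ (fun _ _ _ _ hab => Nat.add_right_cancel hab) ?_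
  · intro j hj
    simp only [Finset.mem_filter, Finset.mem_Icc] at hj ⊢
    rw [OZd_of_two_le h d (by omega)] at hj
    have hlt : d + i < lam (j + d) := by omega
    refine ⟨⟨by omega, ?_⟩, by omega, hlt⟩
    by_contra hcon
    have := h.2.2.2 (j + d) (Or.inr (by omega))
    omega
  · intro j hj
    simp only [Finset.mem_filter, Finset.mem_Icc] at hj
    refine ⟨j - d, ?_, by omega⟩
    simp only [Finset.mem_filter, Finset.mem_Icc]
    rw [OZd_of_two_le h d (by omega), show j - d + d = j by omega]
    omega

/-- For `λ ∈ BC(k, 2n+1)` with `λ_1 = 2n+1-k` and `d₁, d₂ ≥ 1`: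
`λ ∈ Comp_BC(d₁+d₂) ↔ λ^{O_Z(d₁)} ∈ Comp_BC(d₂)`. -/
theorem statement13 (n k : ℕ) (hn : 1 ≤ n) (hk : 1 ≤ k) (hk' : k ≤ n+1)
    (lam : ℕ → ℤ) (hlam : IsBCodd n k lam) (hlam1 : lam 1 = 2*(n:ℤ)+1-k)
    (d1 d2 : ℕ) (hd1 : 1 ≤ d1) (hd2 : 1 ≤ d2) :
    CompBC n k (d1+d2) lam ↔ CompBC n k d2 (OZd k lam d1) := by
  have hp := hlam.1
  have hB := hlam.OZd hk hk' hlam1 d1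
  have hell := elld_OZd hp (show 0 ≤ (d2:ℤ) - 1 by omega) d1 (show 1 ≤ d2 + 1 by omega)
  have hval := OZd_of_two_le hp d1 (show 2 ≤ d2 + 1 by omega)
  rw [show (d1:ℤ) + ((d2:ℤ) - 1) = ((d1 + d2 : ℕ) : ℤ) - 1 by push_cast; ring,
    ← Nat.add_assoc] at hell
  rw [show d2 + 1 + d1 = d1 + d2 + 1 by omega] at hval
  simp only [CompBC, hlam, hlam1, hB, OZd_one, true_and, hell, hval]
  push_cast
  omega

end
end OddSymplectic
end
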